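/- For |q|<1, the identity Σ_{n∈ℤ, n≠0} (-1)^n q^{9n²+3n}/(1-q^{9n}) + Σ_{n∈ℤ} (-1)^n q^{9n²+15n+6}/(1-q^{9n+6}) = (2 J_{3,18}/J_{9,18})·Σ_{n∈ℤ} (-1)^n q^{9n²+9n+3}/(1-q^{9n+3}) + J_{3,18}⁶ J₆³ J_{9,18}²/(6 J₁₈⁹) − 1/6 holds. -/

import Mathlib

open scoped BigOperators

noncomputable def poch (a q : ℂ) : ℂ := ∏' n : ℕ, (1 - a * q ^ n)

noncomputable def Jm (m : ℕ) (q : ℂ) : ℂ := poch (q ^ m) (q ^ m)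

noncomputable def Jam (a m : ℕ) (q : ℂ) : ℂ :=
  poch (q ^ a) (q ^ m) * poch (q ^ (m - a)) (q ^ m) * poch (q ^ m) (q ^ m)

noncomputable def Sser (a Q : ℂ) : ℂ :=
  ∑' n : ℕ, (1 / (1 - a * Q ^ n) - 1 / (1 - a⁻¹ * Q ^ (n + 1)))

open Filter Topology

section Pochhammer

variable {a q : ℂ}

lemma summable_norm_mul_pow (a : ℂ) (hq : ‖q‖ < 1) : Summable fun n : ℕ => ‖-(a * q ^ n)‖ := by
  simpa [norm_mul, norm_pow] using
    (summable_geometric_of_lt_one (norm_nonneg q) hq).mul_left ‖a‖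

lemma multipliable_poch (a : ℂ) (hq : ‖q‖ < 1) : Multipliable fun n : ℕ => 1 - a * q ^ n := by
  simpa [sub_eq_add_neg] using multipliable_one_add_of_summable (summable_norm_mul_pow a hq)

lemma poch_ne_zero (hq : ‖q‖ < 1) (h : ∀ n : ℕ, a * q ^ n ≠ 1) : poch a q ≠ 0 := by
  have := tprod_one_add_ne_zero_of_summable (f := fun n : ℕ => -(a * q ^ n))
    (fun n => by simpa [← sub_eq_add_neg, sub_eq_zero] using (h n).symm)
    (summable_norm_mul_pow a hq)
  simpa [poch, sub_eq_add_neg] using this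

lemma poch_eq_mul (a : ℂ) (hq : ‖q‖ < 1) : poch a q = (1 - a) * poch (a * q) q := by
  have e : ∀ n : ℕ, a * q * q ^ n = a * q ^ (n + 1) := fun n => by ring
  have hs := multipliable_poch (a * q) hq
  simp only [e] at hs
  have := tprod_eq_zero_mul' (f := fun n : ℕ => 1 - a * q ^ n) hs
  rw [pow_zero, mul_one] at this
  unfold poch
  simp only [e]
  exact this

lemma poch_sq (a : ℂ) (hq : ‖q‖ < 1) : poch (a ^ 2) (q ^ 2) = poch a q * poch (-a) q := by
  unfold poch
  rw [← (multipliable_poch a hq).tprod_mul (multipliable_poch (-a) hq)]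
  refine tprod_congr fun n => ?_
  ring

lemma poch_dissect_two (a : ℂ) (hq : ‖q‖ < 1) :
    poch a q = poch a (q ^ 2) * poch (a * q) (q ^ 2) := by
  have hq2 : ‖q ^ 2‖ < 1 := by
    rw [norm_pow]; exact pow_lt_one₀ (norm_nonneg _) hq two_ne_zero
  have h0 := multipliable_poch a hq2
  have h1 := multipliable_poch (a * q) hq2
  have e : ∀ n : ℕ, a * q * (q ^ 2) ^ n = a * q ^ (2 * n + 1) := fun n => by ring
  simp only [e] at h1
  simp only [← pow_mul] at h0
  have := tprod_even_mul_odd (f := fun n : ℕ => 1 - a * q ^ n) h0 h1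
  unfold poch
  simp only [e]
  simp only [← pow_mul]
  exact this.symm

lemma poch_dissect_three (a : ℂ) (hq : ‖q‖ < 1) :
    poch a q = poch a (q ^ 3) * poch (a * q) (q ^ 3) * poch (a * q ^ 2) (q ^ 3) := by
  have hm := multipliable_poch a hq
  have h3 : ‖q ^ 3‖ < 1 := by
    rw [norm_pow]; exact pow_lt_one₀ (norm_nonneg _) hq three_ne_zero
  refine tendsto_nhds_unique (f := fun N : ℕ => ∏ i ∈ Finset.range (3 * N), (1 - a * q ^ i))
    (hm.hasProd.tendsto_prod_nat.comp (tendsto_id.const_mul_atTop' (by norm_num : 0 < 3))) ?_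
  have e : ∀ N : ℕ, ∏ i ∈ Finset.range (3 * N), (1 - a * q ^ i) =
      (∏ i ∈ Finset.range N, (1 - a * (q ^ 3) ^ i)) *
      (∏ i ∈ Finset.range N, (1 - a * q * (q ^ 3) ^ i)) *
      (∏ i ∈ Finset.range N, (1 - a * q ^ 2 * (q ^ 3) ^ i)) := by
    intro N
    induction N with
    | zero => simp
    | succ N ih =>
      rw [mul_add, mul_one, Finset.prod_range_succ, Finset.prod_range_succ, Finset.prod_range_succ,
        ih, Finset.prod_range_succ, Finset.prod_range_succ, Finset.prod_range_succ]
      ring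
  simp only [e]
  exact (((multipliable_poch a h3).hasProd.tendsto_prod_nat.mul
    (multipliable_poch (a * q) h3).hasProd.tendsto_prod_nat).mul
    (multipliable_poch (a * q ^ 2) h3).hasProd.tendsto_prod_nat)

lemma differentiable_poch (hq : ‖q‖ < 1) : Differentiable ℂ fun a => poch a q := by
  intro z
  have hK : IsOpen (Metric.ball (0 : ℂ) (‖z‖ + 1)) := Metric.isOpen_ball
  have hz : z ∈ Metric.ball (0 : ℂ) (‖z‖ + 1) := by simp
  have hu : Summable fun n : ℕ => (‖z‖ + 1) * ‖q‖ ^ n :=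
    (summable_geometric_of_lt_one (norm_nonneg q) hq).mul_left _
  have hm := hu.hasProdLocallyUniformlyOn_nat_one_add
    (f := fun (n : ℕ) (a : ℂ) => -(a * q ^ n)) hK
    (Eventually.of_forall fun n x hx => by
      rw [norm_neg, norm_mul, norm_pow]
      have : ‖x‖ ≤ ‖z‖ + 1 := (by simpa using hx : ‖x‖ < ‖z‖ + 1).le
      gcongr)
    (fun n => by fun_prop)
  have hd := hm.differentiableOn (.of_forall fun s => by
    simpa [Finset.prod_fn] using DifferentiableOn.finsetProd (fun _ _ ↦ by fun_prop)) hK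
  have := hd.differentiableAt (hK.mem_nhds hz)
  simpa [poch, sub_eq_add_neg] using this

end Pochhammer

section Theta

variable {q y : ℂ}

/-- The modified theta function `(y; q)_∞ (q / y; q)_∞`. -/
noncomputable def qtheta (q y : ℂ) : ℂ := poch y q * poch (q / y) q

/-- The quotient of `qtheta q y` by its factor `1 - y`. -/
noncomputable def qthetaCore (q y : ℂ) : ℂ := poch (q * y) q * poch (q / y) q

/-- Minus the logarithmic derivative `y θ'(y) / θ(y)` of `qtheta q`. -/
noncomputable def qthetaLog (q y : ℂ) : ℂ := -y * deriv (qtheta q) y / qtheta q y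

lemma qtheta_eq_mul_core (hq : ‖q‖ < 1) (y : ℂ) : qtheta q y = (1 - y) * qthetaCore q y := by
  rw [qtheta, poch_eq_mul y hq, qthetaCore, mul_comm y q, mul_assoc]

lemma analyticAt_poch_comp (hq : ‖q‖ < 1) {u : ℂ → ℂ} (hu : AnalyticAt ℂ u y) :
    AnalyticAt ℂ (fun y => poch (u y) q) y :=
  ((differentiable_poch hq).analyticAt (u y)).fun_comp hu

lemma analyticAt_qtheta (hq : ‖q‖ < 1) (hy : y ≠ 0) : AnalyticAt ℂ (qtheta q) y :=
  (analyticAt_poch_comp hq analyticAt_id).mul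
    (analyticAt_poch_comp hq (analyticAt_const.div analyticAt_id hy))

lemma analyticAt_qthetaCore (hq : ‖q‖ < 1) (hy : y ≠ 0) : AnalyticAt ℂ (qthetaCore q) y :=
  (analyticAt_poch_comp hq (analyticAt_const.mul analyticAt_id)).mul
    (analyticAt_poch_comp hq (analyticAt_const.div analyticAt_id hy))

lemma qthetaCore_ne_zero (hq0 : q ≠ 0) (hq : ‖q‖ < 1) (hy : y ≠ 0)
    (h : ∀ n : ℤ, n ≠ 0 → q ^ n * y ≠ 1) : qthetaCore q y ≠ 0 := by
  refine mul_ne_zero (poch_ne_zero hq fun n hn => ?_) (poch_ne_zero hq fun n hn => ?_)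
  · refine h (n + 1) (by positivity) ?_
    rw [zpow_add_one₀ hq0, zpow_natCast, ← hn]
    ring
  · refine h (-(n + 1)) (by omega) ?_
    have e : q ^ (n + 1) = y := by
      rw [div_mul_eq_mul_div, div_eq_one_iff_eq hy] at hn
      rw [← hn]; ring
    rw [zpow_neg, show ((n : ℤ) + 1) = ((n + 1 : ℕ) : ℤ) by push_cast; ring, zpow_natCast, e]
    exact inv_mul_cancel₀ hy

lemma qtheta_ne_zero (hq0 : q ≠ 0) (hq : ‖q‖ < 1) (hy : y ≠ 0)
    (h : ∀ n : ℤ, q ^ n * y ≠ 1) : qtheta q y ≠ 0 := by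
  rw [qtheta_eq_mul_core hq]
  refine mul_ne_zero (sub_ne_zero.2 ?_) (qthetaCore_ne_zero hq0 hq hy fun n _ => h n)
  simpa using (h 0).symm

lemma qthetaCore_one (q : ℂ) : qthetaCore q 1 = poch q q ^ 2 := by
  simp [qthetaCore, sq]

lemma qthetaCore_inv (q y : ℂ) : qthetaCore q y⁻¹ = qthetaCore q y := by
  simp only [qthetaCore, div_inv_eq_mul, ← div_eq_mul_inv]
  ring

lemma deriv_qthetaCore_one (hq : ‖q‖ < 1) : deriv (qthetaCore q) 1 = 0 := by
  have hd := (analyticAt_qthetaCore hq one_ne_zero).differentiableAt.hasDerivAt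
  have hi : HasDerivAt (fun y : ℂ => y⁻¹) (-1) 1 := by
    simpa using hasDerivAt_inv (one_ne_zero (α := ℂ))
  have hd' : HasDerivAt (qthetaCore q) (deriv (qthetaCore q) 1) ((1 : ℂ)⁻¹) := by
    rwa [inv_one]
  have hc := hd'.comp (1 : ℂ) hi
  have e : qthetaCore q ∘ (fun y : ℂ => y⁻¹) = qthetaCore q := funext (qthetaCore_inv q)
  rw [e] at hc
  have := hc.unique hd
  linear_combination (-1 / 2 : ℂ) * this

lemma qtheta_inv (hq : ‖q‖ < 1) (hy : y ≠ 0) : qtheta q y⁻¹ = -y⁻¹ * qtheta q y := by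
  rw [qtheta_eq_mul_core hq, qtheta_eq_mul_core hq, qthetaCore_inv]
  field_simp
  ring

lemma qtheta_div (hq0 : q ≠ 0) : qtheta q (q / y) = qtheta q y := by
  rw [qtheta, qtheta, div_div_cancel₀ hq0, mul_comm]

lemma qtheta_mul (hq0 : q ≠ 0) (hq : ‖q‖ < 1) (hy : y ≠ 0) :
    qtheta q (q * y) = -y⁻¹ * qtheta q y := by
  rw [← qtheta_inv hq hy, ← qtheta_div hq0 (y := y⁻¹), div_inv_eq_mul]

lemma qthetaLog_inv (hq : ‖q‖ < 1) (hy : y ≠ 0) (h : qtheta q y ≠ 0) :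
    qthetaLog q y⁻¹ = -qthetaLog q y - 1 := by
  have hd := (analyticAt_qtheta hq hy).differentiableAt.hasDerivAt
  have hd' := (analyticAt_qtheta hq (inv_ne_zero hy)).differentiableAt.hasDerivAt
  have h1 := hd'.comp y (hasDerivAt_inv hy)
  have h2 := (hasDerivAt_inv hy).neg.mul hd
  have e : qtheta q ∘ (fun y => y⁻¹) =ᶠ[𝓝 y] (-(fun y : ℂ => y⁻¹)) * qtheta q := by
    filter_upwards [isOpen_ne.mem_nhds hy] with w hw
    simpa using qtheta_inv hq hw
  have := (h1.congr_of_eventuallyEq e.symm).unique h2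
  simp only [Pi.neg_apply] at this
  have h3 : deriv (qtheta q) y⁻¹ = -qtheta q y + y * deriv (qtheta q) y := by
    generalize deriv (qtheta q) y⁻¹ = d at this ⊢
    field_simp at this
    linear_combination -this
  rw [qthetaLog, qthetaLog, h3, qtheta_inv hq hy]
  field_simp
  ring

lemma qthetaLog_mul (hq0 : q ≠ 0) (hq : ‖q‖ < 1) (hy : y ≠ 0) (h : qtheta q y ≠ 0) :
    qthetaLog q (q * y) = qthetaLog q y + 1 := by
  have hd := (analyticAt_qtheta hq hy).differentiableAt.hasDerivAt
  have hd' := (analyticAt_qtheta hq (mul_ne_zero hq0 hy)).differentiableAt.hasDerivAt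
  have h1 := hd'.comp y ((hasDerivAt_id y).const_mul q)
  have h2 := (hasDerivAt_inv hy).neg.mul hd
  have e : qtheta q ∘ (fun y => q * y) =ᶠ[𝓝 y] (-(fun y : ℂ => y⁻¹)) * qtheta q := by
    filter_upwards [isOpen_ne.mem_nhds hy] with w hw
    simpa using qtheta_mul hq0 hq hw
  have := (h1.congr_of_eventuallyEq e.symm).unique h2
  simp only [Pi.neg_apply] at this
  have h3 : q * deriv (qtheta q) (q * y) = (y ^ 2)⁻¹ * qtheta q y - y⁻¹ * deriv (qtheta q) y := by
    linear_combination this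
  rw [qthetaLog, qthetaLog, qtheta_mul hq0 hq hy,
    show -(q * y) * deriv (qtheta q) (q * y) = -y * (q * deriv (qtheta q) (q * y)) by ring, h3]
  field_simp
  ring

lemma qthetaLog_neg_one (hq : ‖q‖ < 1) (h : qtheta q (-1) ≠ 0) : qthetaLog q (-1) = -1 / 2 := by
  have := qthetaLog_inv hq (neg_ne_zero.2 one_ne_zero) h
  rw [inv_neg, inv_one] at this
  linear_combination this / 2

lemma analyticAt_qthetaLog (hq : ‖q‖ < 1) (hy : y ≠ 0) (h : qtheta q y ≠ 0) :
    AnalyticAt ℂ (qthetaLog q) y :=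
  (analyticAt_id.neg.mul (analyticAt_qtheta hq hy).deriv).div (analyticAt_qtheta hq hy) h

/-- Separation of the pole of `qthetaLog` at `1`. -/
lemma qthetaLog_eq (hq : ‖q‖ < 1) (hy : y ≠ 0) (h : qtheta q y ≠ 0) :
    qthetaLog q y = y / (1 - y) - y * deriv (qthetaCore q) y / qthetaCore q y := by
  have hc := (analyticAt_qthetaCore hq hy).differentiableAt.hasDerivAt
  have h1 := ((hasDerivAt_id y).const_sub 1).mul hc
  have e : qtheta q = (fun y => 1 - y) * qthetaCore q := funext (qtheta_eq_mul_core hq)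
  have hd : deriv (qtheta q) y = -qthetaCore q y + (1 - y) * deriv (qthetaCore q) y := by
    rw [e]
    simpa using h1.deriv
  rw [qtheta_eq_mul_core hq] at h
  obtain ⟨h2, h3⟩ := mul_ne_zero_iff.1 h
  rw [qthetaLog, hd, qtheta_eq_mul_core hq]
  field_simp
  ring

end Theta

section Liouville

variable {f a b : ℂ → ℂ} {q z : ℂ}

/-- `f` coincides, on a punctured neighbourhood of `z`, with a function analytic at `z`. -/
def RemovableAt (f : ℂ → ℂ) (z : ℂ) : Prop :=
  ∃ g : ℂ → ℂ, AnalyticAt ℂ g z ∧ f =ᶠ[𝓝[≠] z] g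

lemma AnalyticAt.removableAt (h : AnalyticAt ℂ f z) : RemovableAt f z :=
  ⟨f, h, EventuallyEq.rfl⟩

lemma AnalyticAt.eq_of_eventuallyEq_punctured {g h : ℂ → ℂ} (hg : AnalyticAt ℂ g z)
    (hh : AnalyticAt ℂ h z) (e : g =ᶠ[𝓝[≠] z] h) : g z = h z :=
  tendsto_nhds_unique (hg.continuousAt.tendsto.mono_left nhdsWithin_le_nhds)
    ((hh.continuousAt.tendsto.mono_left nhdsWithin_le_nhds).congr' e.symm)

lemma tendsto_const_mul_punctured (hq : q ≠ 0) (z : ℂ) :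
    Tendsto (fun w => q * w) (𝓝[≠] z) (𝓝[≠] (q * z)) := by
  refine tendsto_nhdsWithin_iff.2 ⟨?_, ?_⟩
  · exact ((continuous_const_mul q).tendsto z).mono_left nhdsWithin_le_nhds
  · filter_upwards [self_mem_nhdsWithin] with w hw
    simpa [hq] using hw

lemma exists_analytic_extension (h : ∀ z ≠ 0, RemovableAt f z) :
    ∃ F : ℂ → ℂ, ∀ z ≠ 0, AnalyticAt ℂ F z ∧ f =ᶠ[𝓝[≠] z] F := by
  refine ⟨fun z => limUnder (𝓝[≠] z) f, fun z hz => ?_⟩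
  obtain ⟨g, hg, hfg⟩ := h z hz
  have key : ∀ᶠ w in 𝓝 z, limUnder (𝓝[≠] w) f = g w := by
    have h1 : ∀ᶠ w in 𝓝 z, ∀ᶠ u in 𝓝[≠] w, f u = g u := by
      have h2 := eventually_nhdsWithin_iff.1 hfg
      filter_upwards [eventually_eventually_nhds.2 h2] with w hw
      by_cases hwz : w = z
      · subst hwz; exact eventually_nhdsWithin_iff.2 hw
      · filter_upwards [nhdsWithin_le_nhds hw,
          nhdsWithin_le_nhds (isOpen_ne.mem_nhds hwz)] with u hu hu' using hu hu'
    filter_upwards [h1, hg.eventually_analyticAt] with w hw hgw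
    exact ((hgw.continuousAt.tendsto.mono_left nhdsWithin_le_nhds).congr'
      (hw.mono fun _ h => h.symm)).limUnder_eq
  refine ⟨hg.congr (key.mono fun _ h => h.symm), ?_⟩
  filter_upwards [hfg, nhdsWithin_le_nhds key] with w h1 h2
  rw [h1, h2]

lemma RemovableAt.mul_left (hq : q ≠ 0) (ha : AnalyticAt ℂ a z) (hb : AnalyticAt ℂ b z)
    (hf : ∀ᶠ w in 𝓝[≠] z, f (q * w) = a w * f w + b w) (h : RemovableAt f z) :
    RemovableAt f (q * z) := by
  obtain ⟨g, hg, hfg⟩ := h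
  have hz : q⁻¹ * (q * z) = z := by field_simp
  have han : AnalyticAt ℂ (fun w : ℂ => q⁻¹ * w) (q * z) := by fun_prop
  refine ⟨fun w => a (q⁻¹ * w) * g (q⁻¹ * w) + b (q⁻¹ * w), ?_, ?_⟩
  · refine ((AnalyticAt.fun_comp ?_ han).mul (AnalyticAt.fun_comp ?_ han)).add
      (AnalyticAt.fun_comp ?_ han)
    all_goals rwa [hz]
  · have ht := tendsto_const_mul_punctured (inv_ne_zero hq) (q * z)
    rw [hz] at ht
    filter_upwards [ht.eventually hf, ht.eventually hfg] with w h1 h2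
    rw [← h2, ← h1, mul_inv_cancel_left₀ hq]

lemma RemovableAt.of_mul_left (hq : q ≠ 0) (ha : AnalyticAt ℂ a z) (hb : AnalyticAt ℂ b z)
    (ha0 : a z ≠ 0) (hf : ∀ᶠ w in 𝓝[≠] z, f (q * w) = a w * f w + b w)
    (h : RemovableAt f (q * z)) : RemovableAt f z := by
  obtain ⟨g, hg, hfg⟩ := h
  have han : AnalyticAt ℂ (fun w : ℂ => q * w) z := by fun_prop
  refine ⟨fun w => (g (q * w) - b w) / a w, ((hg.fun_comp han).sub hb).div ha ha0, ?_⟩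
  filter_upwards [hf, (tendsto_const_mul_punctured hq z).eventually hfg,
    nhdsWithin_le_nhds (ha.continuousAt.eventually_ne ha0)] with w h1 h2 h3
  rw [← h2, h1]
  field_simp
  ring

lemma RemovableAt.zpow_mul (hq : q ≠ 0) (ha : ∀ z ≠ 0, AnalyticAt ℂ a z)
    (hb : ∀ z ≠ 0, AnalyticAt ℂ b z) (ha0 : ∀ z ≠ 0, a z ≠ 0)
    (hf : ∀ z ≠ 0, ∀ᶠ w in 𝓝[≠] z, f (q * w) = a w * f w + b w) (hz : z ≠ 0)
    (h : RemovableAt f z) (n : ℤ) : RemovableAt f (q ^ n * z) := by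
  induction n with
  | zero => simpa using h
  | succ n ih =>
    have h0 : q ^ (n : ℤ) * z ≠ 0 := mul_ne_zero (zpow_ne_zero _ hq) hz
    have := ih.mul_left hq (ha _ h0) (hb _ h0) (hf _ h0)
    rwa [← mul_assoc, ← zpow_one_add₀ hq, add_comm] at this
  | pred n ih =>
    have h0 : q ^ (-(n : ℤ) - 1) * z ≠ 0 := mul_ne_zero (zpow_ne_zero _ hq) hz
    refine RemovableAt.of_mul_left hq (ha _ h0) (hb _ h0) (ha0 _ h0) (hf _ h0) ?_
    rwa [← mul_assoc, ← zpow_one_add₀ hq, add_sub_cancel]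

/-- A function analytic on the punctured plane satisfying `F (q z) = a z F z + b z`, where the
recursion propagates bounds towards `0` and towards `∞`, is constant. -/
lemma exists_eq_const_of_functional_eq {F : ℂ → ℂ} (hq0 : q ≠ 0) (hq : ‖q‖ < 1)
    (hF : ∀ z ≠ 0, AnalyticAt ℂ F z) (hfe : ∀ z ≠ 0, F (q * z) = a z * F z + b z) {M₀ : ℝ}
    (hin : ∀ M ≥ M₀, ∀ z ≠ 0, ‖z‖ ≤ 1 / 2 → ∀ s : ℂ, ‖s‖ ≤ M → ‖a z * s + b z‖ ≤ M)
    (hout : ∀ M ≥ M₀, ∀ z : ℂ, 2 ≤ ‖z‖ → ∀ s : ℂ, ‖a z * s + b z‖ ≤ M → ‖s‖ ≤ M) :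
    ∃ c, ∀ z ≠ 0, F z = c := by
  set r := ‖q‖ with hr
  have hr0 : 0 < r := norm_pos_iff.2 hq0
  have hbdd : ∃ M, ∀ z ≠ 0, ‖F z‖ ≤ M := by
    have hK : IsCompact (Metric.closedBall (0 : ℂ) (2 / r) ∩ {z : ℂ | r / 2 ≤ ‖z‖}) :=
      (isCompact_closedBall _ _).inter_right (isClosed_le continuous_const continuous_norm)
    obtain ⟨M₁, hM₁⟩ := hK.exists_bound_of_continuousOn (f := F) fun z hz =>
      (hF z (norm_pos_iff.1 (lt_of_lt_of_le (by positivity) hz.2))).continuousAt.continuousWithinAt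
    set M := max M₁ M₀
    have hM0 : M ≥ M₀ := le_max_right _ _
    have main : ∀ n : ℕ, ∀ z : ℂ, r ^ (n + 1) / 2 ≤ ‖z‖ → ‖z‖ ≤ 2 / r ^ (n + 1) → ‖F z‖ ≤ M := by
      intro n
      induction n with
      | zero =>
        intro z h1 h2
        rw [zero_add, pow_one] at h1 h2
        exact (hM₁ z ⟨by simpa using h2, h1⟩).trans (le_max_left _ _)
      | succ n ih =>
        intro z h1 h2
        have hrn : r ^ (n + 1) ≤ 1 := pow_le_one₀ hr0.le hq.le
        have hrn' : r ^ n ≤ 1 := pow_le_one₀ hr0.le hq.le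
        have hrp : 0 < r ^ (n + 1) := by positivity
        have hz : z ≠ 0 := norm_pos_iff.1 (lt_of_lt_of_le (by positivity) h1)
        by_cases hs : ‖z‖ < r ^ (n + 1) / 2
        · have hw : z / q ≠ 0 := div_ne_zero hz hq0
          have hnw : ‖z / q‖ = ‖z‖ / r := by rw [norm_div]
          have hw2 : ‖z / q‖ ≤ 1 / 2 := by
            rw [hnw, div_le_iff₀ hr0]
            rw [pow_succ] at hs
            nlinarith
          have := hin M hM0 _ hw hw2 (F (z / q)) (ih _ ?_ ?_)
          · rwa [← hfe _ hw, mul_div_cancel₀ _ hq0] at this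
          · rw [hnw, le_div_iff₀ hr0]
            rw [pow_succ] at h1
            linarith
          · have : 1 ≤ 2 / r ^ (n + 1) := by
              rw [le_div_iff₀ hrp]; linarith
            linarith
        · rw [not_lt] at hs
          by_cases hl : ‖z‖ ≤ 2 / r ^ (n + 1)
          · exact ih z hs hl
          · rw [not_le] at hl
            have h2z : 2 ≤ ‖z‖ := by
              refine le_trans ?_ hl.le
              rw [le_div_iff₀ hrp]; linarith
            have hnz : ‖q * z‖ = r * ‖z‖ := norm_mul _ _
            refine hout M hM0 z h2z _ ?_
            rw [← hfe z hz]
            refine ih _ ?_ ?_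
            · rw [hnz, pow_succ]
              nlinarith
            · rw [hnz]
              rw [le_div_iff₀ (by positivity)] at h2 ⊢
              rw [pow_succ] at h2
              linarith
    refine ⟨M, fun z hz => ?_⟩
    have hz' : 0 < ‖z‖ := norm_pos_iff.2 hz
    obtain ⟨n, hn⟩ := exists_pow_lt_of_lt_one (show 0 < min (2 * ‖z‖) (2 / ‖z‖) by positivity) hq
    have hn' : r ^ (n + 1) < min (2 * ‖z‖) (2 / ‖z‖) := by
      refine lt_of_le_of_lt ?_ hn
      exact pow_le_pow_of_le_one hr0.le hq.le (Nat.le_succ n)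
    obtain ⟨h1, h2⟩ := lt_min_iff.1 hn'
    refine main n z (by linarith) ?_
    rw [le_div_iff₀ (by positivity)]
    rw [lt_div_iff₀ hz'] at h2
    linarith
  obtain ⟨M, hM⟩ := hbdd
  have hd : Differentiable ℂ fun w => F (Complex.exp w) := fun w =>
    (hF _ (Complex.exp_ne_zero w)).differentiableAt.comp w Complex.differentiableAt_exp
  have hb : Bornology.IsBounded (Set.range fun w => F (Complex.exp w)) :=
    isBounded_iff_forall_norm_le.2 ⟨M, by rintro _ ⟨w, rfl⟩; exact hM _ (Complex.exp_ne_zero w)⟩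
  refine ⟨F 1, fun z hz => ?_⟩
  have := hd.apply_eq_apply_of_bounded hb (Complex.log z) 0
  simpa [Complex.exp_log hz] using this

/-- Liouville's theorem for quasi-periodic functions on the punctured plane, all of whose
singularities are removable. -/
theorem eventuallyEq_const_of_functional_eq (hq0 : q ≠ 0) (hq : ‖q‖ < 1)
    (ha : ∀ z ≠ 0, AnalyticAt ℂ a z) (hb : ∀ z ≠ 0, AnalyticAt ℂ b z)
    (hfe : ∀ z ≠ 0, ∀ᶠ w in 𝓝[≠] z, f (q * w) = a w * f w + b w)
    (hrem : ∀ z ≠ 0, RemovableAt f z) {M₀ : ℝ}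
    (hin : ∀ M ≥ M₀, ∀ z ≠ 0, ‖z‖ ≤ 1 / 2 → ∀ s : ℂ, ‖s‖ ≤ M → ‖a z * s + b z‖ ≤ M)
    (hout : ∀ M ≥ M₀, ∀ z : ℂ, 2 ≤ ‖z‖ → ∀ s : ℂ, ‖a z * s + b z‖ ≤ M → ‖s‖ ≤ M) :
    ∃ c : ℂ, (∀ z ≠ 0, f =ᶠ[𝓝[≠] z] fun _ => c) ∧ ∀ z ≠ 0, c = a z * c + b z := by
  obtain ⟨F, hF⟩ := exists_analytic_extension hrem
  have hFe : ∀ z ≠ 0, F (q * z) = a z * F z + b z := by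
    intro z hz
    have hqz : q * z ≠ 0 := mul_ne_zero hq0 hz
    have han : AnalyticAt ℂ (fun w : ℂ => q * w) z := by fun_prop
    refine AnalyticAt.eq_of_eventuallyEq_punctured (g := fun w => F (q * w))
      (h := fun w => a w * F w + b w) ((hF _ hqz).1.fun_comp han)
      (((ha z hz).mul (hF z hz).1).add (hb z hz)) ?_
    filter_upwards [hfe z hz, (hF z hz).2,
      (tendsto_const_mul_punctured hq0 z).eventually (hF _ hqz).2] with w h1 h2 h3
    rw [← h2, ← h3, h1]
  obtain ⟨c, hc⟩ := exists_eq_const_of_functional_eq hq0 hq (fun z hz => (hF z hz).1) hFe hin hout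
  refine ⟨c, fun z hz => ?_, fun z hz => ?_⟩
  · filter_upwards [(hF z hz).2, nhdsWithin_le_nhds (isOpen_ne.mem_nhds hz)] with w h1 h2
    rw [h1, hc w h2]
  · have := hFe z hz
    rwa [hc z hz, hc _ (mul_ne_zero hq0 hz)] at this

/-- Cancellation of a simple pole, with the value of the analytic extension at the pole. -/
lemma exists_extension_of_simple_pole {h g : ℂ → ℂ} {p : ℂ} (hp : p ≠ 0) (hh : AnalyticAt ℂ h p)
    (hg : AnalyticAt ℂ g p)
    (hf : ∀ᶠ w in 𝓝[≠] p, f w = h w + (g p - g w) / (1 - w / p)) :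
    ∃ F : ℂ → ℂ, AnalyticAt ℂ F p ∧ f =ᶠ[𝓝[≠] p] F ∧ F p = h p + p * deriv g p := by
  have hs : AnalyticAt ℂ (dslope g p) p := by
    obtain ⟨s, hs, hgs⟩ := hg.exists_mem_nhds_analyticOnNhd
    obtain ⟨t, hts, hto, hpt⟩ := mem_nhds_iff.1 hs
    have hd : DifferentiableOn ℂ g t := fun w hw =>
      (hgs w (hts hw)).differentiableAt.differentiableWithinAt
    exact ((Complex.differentiableOn_dslope (hto.mem_nhds hpt)).2 hd).analyticAt
      (hto.mem_nhds hpt)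
  refine ⟨fun w => h w + p * dslope g p w, hh.add (analyticAt_const.mul hs), ?_, by simp⟩
  filter_upwards [hf, self_mem_nhdsWithin] with w h1 h2
  have h2' : w ≠ p := h2
  rw [h1, dslope_of_ne _ h2', slope_def_field]
  have h3 : w - p ≠ 0 := sub_ne_zero.2 h2'
  have h4 : 1 - w / p ≠ 0 := by
    rw [sub_ne_zero, ne_eq, eq_div_iff hp, one_mul]; exact h2'.symm
  rw [show (1 : ℂ) - w / p = -(w - p) / p by field_simp; ring]
  field_simp
  ring

end Liouville

section ThetaLogAddition

variable {q b c z : ℂ}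

lemma zpow_mul_ne_one_of_norm_eq_one (hq : ‖q‖ < 1) (hb : ‖b‖ = 1) (hb1 : b ≠ 1)
    (n : ℤ) : q ^ n * b ≠ 1 := by
  intro h
  have hn : ‖q‖ ^ n = 1 := by simpa [hb] using congrArg norm h
  obtain rfl := (zpow_eq_one_iff_right₀ (norm_nonneg q) hq.ne).1 hn
  exact hb1 (by simpa using h)

lemma qtheta_neg_one_ne_zero (hq0 : q ≠ 0) (hq : ‖q‖ < 1) : qtheta q (-1) ≠ 0 :=
  qtheta_ne_zero hq0 hq (by norm_num)
    (zpow_mul_ne_one_of_norm_eq_one hq (by simp) (by norm_num))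

lemma analyticAt_qtheta_mul (hq : ‖q‖ < 1) (hc : c ≠ 0) (hz : z ≠ 0) :
    AnalyticAt ℂ (fun w => qtheta q (c * w)) z :=
  (analyticAt_qtheta hq (mul_ne_zero hc hz)).fun_comp (f := fun w => c * w) (by fun_prop)

lemma analyticAt_qthetaCore_mul (hq : ‖q‖ < 1) (hc : c ≠ 0) (hz : z ≠ 0) :
    AnalyticAt ℂ (fun w => qthetaCore q (c * w)) z :=
  (analyticAt_qthetaCore hq (mul_ne_zero hc hz)).fun_comp (f := fun w => c * w) (by fun_prop)

lemma analyticAt_qthetaLog_mul (hq : ‖q‖ < 1) (hc : c ≠ 0) (hz : z ≠ 0)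
    (h : qtheta q (c * z) ≠ 0) : AnalyticAt ℂ (fun w => qthetaLog q (c * w)) z :=
  (analyticAt_qthetaLog hq (mul_ne_zero hc hz) h).fun_comp (f := fun w => c * w) (by fun_prop)

lemma eventually_qtheta_mul_ne_zero (hq0 : q ≠ 0) (hq : ‖q‖ < 1) (hc : c ≠ 0) (hz : z ≠ 0) :
    ∀ᶠ w in 𝓝[≠] z, qtheta q (c * w) ≠ 0 := by
  refine (analyticAt_qtheta_mul hq hc hz).eventually_eq_zero_or_eventually_ne_zero.resolve_left
    fun h => ?_
  have han : AnalyticOnNhd ℂ (fun w => qtheta q (c * w)) {0}ᶜ := fun w hw =>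
    analyticAt_qtheta_mul hq hc hw
  have hpc : IsPreconnected ({0}ᶜ : Set ℂ) :=
    (isConnected_compl_singleton_of_one_lt_rank (by simp) 0).isPreconnected
  have := han.eqOn_zero_of_preconnected_of_eventuallyEq_zero hpc hz h
    (show -1 / c ∈ ({0}ᶜ : Set ℂ) from div_ne_zero (by norm_num) hc)
  simp only [Pi.zero_apply, mul_div_cancel₀ _ hc] at this
  exact qtheta_neg_one_ne_zero hq0 hq this

/-- The difference of the two sides of the addition formula for `qthetaLog` at `a, b, b`. -/
noncomputable def thetaLogDefect (q b a : ℂ) : ℂ :=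
  qthetaLog q a + 2 * qthetaLog q b - qthetaLog q (b ^ 2 * a) + 1
    - poch q q ^ 2 * qtheta q (b * a) ^ 2 * qtheta q (b ^ 2)
      / (qtheta q a * qtheta q b ^ 2 * qtheta q (b ^ 2 * a))

lemma analyticAt_thetaLogDefect (hq : ‖q‖ < 1) (hb0 : b ≠ 0) (hz : z ≠ 0)
    (hb : qtheta q b ≠ 0) (h1 : qtheta q z ≠ 0) (h2 : qtheta q (b ^ 2 * z) ≠ 0) :
    AnalyticAt ℂ (thetaLogDefect q b) z := by
  have hb2 : b ^ 2 ≠ 0 := pow_ne_zero 2 hb0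
  refine ((((analyticAt_qthetaLog hq hz h1).add analyticAt_const).sub
    (analyticAt_qthetaLog_mul hq hb2 hz h2)).add analyticAt_const).sub
    (((analyticAt_const.mul ((analyticAt_qtheta_mul hq hb0 hz).pow 2)).mul analyticAt_const).div
      (((analyticAt_qtheta hq hz).mul analyticAt_const).mul (analyticAt_qtheta_mul hq hb2 hz)) ?_)
  exact mul_ne_zero (mul_ne_zero h1 (pow_ne_zero 2 hb)) h2

lemma thetaLogDefect_mul (hq0 : q ≠ 0) (hq : ‖q‖ < 1) (hb0 : b ≠ 0) (hz : z ≠ 0)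
    (h1 : qtheta q z ≠ 0) (h2 : qtheta q (b ^ 2 * z) ≠ 0) :
    thetaLogDefect q b (q * z) = thetaLogDefect q b z := by
  have hb2 : b ^ 2 ≠ 0 := pow_ne_zero 2 hb0
  have e1 : b * (q * z) = q * (b * z) := by ring
  have e2 : b ^ 2 * (q * z) = q * (b ^ 2 * z) := by ring
  rw [thetaLogDefect, e1, e2, qthetaLog_mul hq0 hq hz h1,
    qthetaLog_mul hq0 hq (mul_ne_zero hb2 hz) h2, qtheta_mul hq0 hq hz,
    qtheta_mul hq0 hq (mul_ne_zero hb2 hz), qtheta_mul hq0 hq (mul_ne_zero hb0 hz), thetaLogDefect]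
  have e3 : poch q q ^ 2 * (-(b * z)⁻¹ * qtheta q (b * z)) ^ 2 * qtheta q (b ^ 2) /
      (-z⁻¹ * qtheta q z * qtheta q b ^ 2 * (-(b ^ 2 * z)⁻¹ * qtheta q (b ^ 2 * z))) =
      poch q q ^ 2 * qtheta q (b * z) ^ 2 * qtheta q (b ^ 2)
      / (qtheta q z * qtheta q b ^ 2 * qtheta q (b ^ 2 * z)) := by
    by_cases h : qtheta q b = 0
    · simp [h]
    · field_simp
  rw [e3]
  ring

lemma removableAt_thetaLogDefect_one (hq0 : q ≠ 0) (hq : ‖q‖ < 1) (hb0 : b ≠ 0)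
    (hb : qtheta q b ≠ 0) (hb2 : qtheta q (b ^ 2) ≠ 0) (hP : poch q q ≠ 0) :
    RemovableAt (thetaLogDefect q b) 1 := by
  have hbb : b ^ 2 ≠ 0 := pow_ne_zero 2 hb0
  have hc1 : qthetaCore q 1 ≠ 0 := by rw [qthetaCore_one]; exact pow_ne_zero 2 hP
  have hac := analyticAt_qthetaCore hq (y := 1) one_ne_zero
  have hb2' : qtheta q (b ^ 2 * 1) ≠ 0 := by rwa [mul_one]
  have key : ∀ᶠ w in 𝓝[≠] 1, thetaLogDefect q b w =
      (-(w * deriv (qthetaCore q) w / qthetaCore q w) + 2 * qthetaLog q b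
        - qthetaLog q (b ^ 2 * w))
      + (poch q q ^ 2 * qtheta q (b * 1) ^ 2 * qtheta q (b ^ 2)
          / (qthetaCore q 1 * qtheta q b ^ 2 * qtheta q (b ^ 2 * 1))
        - poch q q ^ 2 * qtheta q (b * w) ^ 2 * qtheta q (b ^ 2)
          / (qthetaCore q w * qtheta q b ^ 2 * qtheta q (b ^ 2 * w))) / (1 - w / 1) := by
    have hne : ∀ᶠ w : ℂ in 𝓝[≠] 1, w ≠ 0 :=
      nhdsWithin_le_nhds (isOpen_ne.mem_nhds one_ne_zero)
    have h1 := eventually_qtheta_mul_ne_zero hq0 hq (c := 1) one_ne_zero one_ne_zero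
    have h2 := eventually_qtheta_mul_ne_zero hq0 hq hbb one_ne_zero
    filter_upwards [hne, h1, h2, self_mem_nhdsWithin] with w hw0 h1 h2 hw1
    rw [one_mul] at h1
    have hw : 1 - w ≠ 0 := sub_ne_zero.2 (Ne.symm hw1)
    rw [thetaLogDefect, qthetaLog_eq hq hw0 h1]
    rw [qtheta_eq_mul_core hq w] at h1 ⊢
    have hcw := (mul_ne_zero_iff.1 h1).2
    rw [qthetaCore_one, mul_one, mul_one]
    field_simp
    ring
  obtain ⟨F, hF, hF', -⟩ := exists_extension_of_simple_pole one_ne_zero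
    ((((analyticAt_id.mul hac.deriv).div hac hc1).neg.add analyticAt_const).sub
      (analyticAt_qthetaLog_mul hq hbb one_ne_zero hb2'))
    (((analyticAt_const.mul ((analyticAt_qtheta_mul hq hb0 one_ne_zero).pow 2)).mul
      analyticAt_const).div ((hac.mul analyticAt_const).mul
        (analyticAt_qtheta_mul hq hbb one_ne_zero))
        (mul_ne_zero (mul_ne_zero hc1 (pow_ne_zero 2 hb)) hb2')) key
  exact ⟨F, hF, hF'⟩

lemma removableAt_thetaLogDefect_inv_sq (hq0 : q ≠ 0) (hq : ‖q‖ < 1) (hb0 : b ≠ 0)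
    (hb : qtheta q b ≠ 0) (hb2 : qtheta q (b ^ 2) ≠ 0) (hP : poch q q ≠ 0) :
    RemovableAt (thetaLogDefect q b) (b ^ 2)⁻¹ := by
  have hbb : b ^ 2 ≠ 0 := pow_ne_zero 2 hb0
  obtain ⟨F, hF, hF'⟩ := removableAt_thetaLogDefect_one hq0 hq hb0 hb hb2 hP
  have hi : AnalyticAt ℂ (fun w => (b ^ 2 * w)⁻¹) (b ^ 2)⁻¹ :=
    (analyticAt_const.mul analyticAt_id).inv (mul_ne_zero hbb (inv_ne_zero hbb))
  have hi1 : (b ^ 2 * (b ^ 2)⁻¹)⁻¹ = 1 := by rw [mul_inv_cancel₀ hbb, inv_one]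
  have ht : Tendsto (fun w => (b ^ 2 * w)⁻¹) (𝓝[≠] (b ^ 2)⁻¹) (𝓝[≠] 1) := by
    refine tendsto_nhdsWithin_iff.2 ⟨?_, ?_⟩
    · have := hi.continuousAt.tendsto
      rw [hi1] at this
      exact this.mono_left nhdsWithin_le_nhds
    · filter_upwards [self_mem_nhdsWithin] with w hw h
      refine hw (eq_inv_of_mul_eq_one_right ?_)
      exact inv_eq_one.1 h
  refine ⟨fun w => F (b ^ 2 * w)⁻¹, AnalyticAt.fun_comp (by rwa [hi1]) hi, ?_⟩
  have hne : ∀ᶠ w : ℂ in 𝓝[≠] (b ^ 2)⁻¹, w ≠ 0 :=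
    nhdsWithin_le_nhds (isOpen_ne.mem_nhds (inv_ne_zero hbb))
  have h1 := eventually_qtheta_mul_ne_zero hq0 hq (c := 1) one_ne_zero (inv_ne_zero hbb)
  have h2 := eventually_qtheta_mul_ne_zero hq0 hq hbb (inv_ne_zero hbb)
  filter_upwards [ht.eventually hF', hne, h1, h2] with w hw hw0 h1 h2
  rw [one_mul] at h1
  have hbw := mul_ne_zero hbb hw0
  have e1 : b * (b ^ 2 * w)⁻¹ = (b * w)⁻¹ := by field_simp
  have e2 : b ^ 2 * (b ^ 2 * w)⁻¹ = w⁻¹ := by field_simp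
  rw [← hw, thetaLogDefect, thetaLogDefect, e1, e2, qthetaLog_inv hq hw0 h1,
    qthetaLog_inv hq hbw h2, qtheta_inv hq hw0, qtheta_inv hq hbw,
    qtheta_inv hq (mul_ne_zero hb0 hw0)]
  field_simp
  ring

lemma exists_zpow_mul_eq_one_of_qtheta_eq_zero (hq0 : q ≠ 0) (hq : ‖q‖ < 1) (hz : z ≠ 0)
    (h : qtheta q z = 0) : ∃ n : ℤ, q ^ n * z = 1 := by
  by_contra! hn
  exact qtheta_ne_zero hq0 hq hz hn h

lemma poch_self_ne_zero (hq : ‖q‖ < 1) : poch q q ≠ 0 :=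
  poch_ne_zero hq fun n h => by
    have h1 : ‖q‖ ^ (n + 1) = 1 := by
      rw [← norm_pow, pow_succ', h, norm_one]
    exact (pow_lt_one₀ (norm_nonneg q) hq n.succ_ne_zero).ne h1

lemma qtheta_one (hq : ‖q‖ < 1) : qtheta q 1 = 0 := by
  simp [qtheta_eq_mul_core hq]

lemma AnalyticAt.eq_const_of_eventuallyEq {f : ℂ → ℂ} (hf : AnalyticAt ℂ f z)
    (h : f =ᶠ[𝓝[≠] z] fun _ => c) : f z = c :=
  hf.eq_of_eventuallyEq_punctured analyticAt_const h

/-- The triplication case of the addition formula for the logarithmic derivative of `qtheta`. -/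
theorem three_mul_qthetaLog (hq0 : q ≠ 0) (hq : ‖q‖ < 1) (hb0 : b ≠ 0) (hb : qtheta q b ≠ 0)
    (hb2 : qtheta q (b ^ 2) ≠ 0) (hb3 : qtheta q (b ^ 3) ≠ 0) :
    3 * qthetaLog q b - qthetaLog q (b ^ 3) + 1 =
      poch q q ^ 2 * qtheta q (b ^ 2) ^ 3 / (qtheta q b ^ 3 * qtheta q (b ^ 3)) := by
  have hP := poch_self_ne_zero hq
  have hbb : b ^ 2 ≠ 0 := pow_ne_zero 2 hb0
  have hfe : ∀ z ≠ 0, ∀ᶠ w in 𝓝[≠] z,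
      thetaLogDefect q b (q * w) = 1 * thetaLogDefect q b w + 0 := by
    intro z hz
    have hne : ∀ᶠ w : ℂ in 𝓝[≠] z, w ≠ 0 := nhdsWithin_le_nhds (isOpen_ne.mem_nhds hz)
    filter_upwards [hne, eventually_qtheta_mul_ne_zero hq0 hq (c := 1) one_ne_zero hz,
      eventually_qtheta_mul_ne_zero hq0 hq hbb hz] with w hw h1 h2
    rw [one_mul, add_zero]
    exact thetaLogDefect_mul hq0 hq hb0 hw (by rwa [one_mul] at h1) h2
  have htr : ∀ p ≠ 0, RemovableAt (thetaLogDefect q b) p → ∀ z, (∃ n : ℤ, q ^ n * z = p) →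
      RemovableAt (thetaLogDefect q b) z := by
    rintro p hp0 hp z ⟨n, rfl⟩
    have := hp.zpow_mul hq0 (a := fun _ => 1) (b := fun _ => 0) (fun _ _ => analyticAt_const)
      (fun _ _ => analyticAt_const) (fun _ _ => one_ne_zero) hfe hp0 (-n)
    rwa [← mul_assoc, ← zpow_add₀ hq0, neg_add_cancel, zpow_zero, one_mul] at this
  have hrem : ∀ z ≠ 0, RemovableAt (thetaLogDefect q b) z := by
    intro z hz
    by_cases h1 : qtheta q z = 0
    · exact htr 1 one_ne_zero (removableAt_thetaLogDefect_one hq0 hq hb0 hb hb2 hP) z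
        (exists_zpow_mul_eq_one_of_qtheta_eq_zero hq0 hq hz h1)
    by_cases h2 : qtheta q (b ^ 2 * z) = 0
    · refine htr _ (inv_ne_zero hbb)
        (removableAt_thetaLogDefect_inv_sq hq0 hq hb0 hb hb2 hP) z ?_
      obtain ⟨n, hn⟩ := exists_zpow_mul_eq_one_of_qtheta_eq_zero hq0 hq (mul_ne_zero hbb hz) h2
      exact ⟨n, eq_inv_of_mul_eq_one_right (by rw [← hn]; ring)⟩
    exact (analyticAt_thetaLogDefect hq hb0 hz hb h1 h2).removableAt
  obtain ⟨c, hc, -⟩ := eventuallyEq_const_of_functional_eq hq0 hq (a := fun _ => 1)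
    (b := fun _ => 0) (fun _ _ => analyticAt_const) (fun _ _ => analyticAt_const) hfe hrem
    (M₀ := 0) (fun M _ z _ _ s hs => by simpa using hs) (fun M _ z _ s hs => by simpa using hs)
  have hbi : qtheta q b⁻¹ ≠ 0 := by
    rw [qtheta_inv hq hb0]
    exact mul_ne_zero (neg_ne_zero.2 (inv_ne_zero hb0)) hb
  have ebi : b ^ 2 * b⁻¹ = b := by field_simp
  have h0 := (analyticAt_thetaLogDefect hq hb0 (inv_ne_zero hb0) hb hbi
    (by rwa [ebi])).eq_const_of_eventuallyEq (hc _ (inv_ne_zero hb0))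
  rw [thetaLogDefect, ebi, mul_inv_cancel₀ hb0, qtheta_one hq, qthetaLog_inv hq hb0 hb] at h0
  have hc0 : c = 0 := by
    rw [← h0]; ring
  have e3 : b ^ 2 * b = b ^ 3 := by ring
  have h := (analyticAt_thetaLogDefect hq hb0 hb0 hb hb
    (by rwa [e3])).eq_const_of_eventuallyEq (hc _ hb0)
  rw [thetaLogDefect, e3, hc0, ← sq, sub_eq_zero] at h
  calc _ = qthetaLog q b + 2 * qthetaLog q b - qthetaLog q (b ^ 3) + 1 := by ring
    _ = _ := by rw [h]; congr 1 <;> ring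

end ThetaLogAddition

section AppellSum

variable {q b y z : ℂ}

lemma summable_norm_pow_sq_mul_zpow (hq0 : q ≠ 0) (hq : ‖q‖ < 1) {r : ℝ} (hr : 0 < r) :
    Summable fun n : ℤ => ‖q‖ ^ (n ^ 2) * r ^ n := by
  have hq' : 0 < ‖q‖ := norm_pos_iff.2 hq0
  have hT : 0 < -Real.log ‖q‖ / Real.pi :=
    div_pos (neg_pos.2 (Real.log_neg hq' hq)) Real.pi_pos
  have h := summable_pow_mul_jacobiTheta₂_term_bound (|Real.log r| / (2 * Real.pi)) hT 0
  refine Summable.of_nonneg_of_le (fun n => by positivity) (fun n => ?_) h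
  rw [pow_zero, one_mul, ← Real.rpow_intCast, ← Real.rpow_intCast, Real.rpow_def_of_pos hq',
    Real.rpow_def_of_pos hr, ← Real.exp_add, Real.exp_le_exp]
  have h1 : Real.log r * n ≤ |Real.log r| * |(n : ℝ)| := by
    rw [← abs_mul]
    exact le_abs_self _
  have hpi := Real.pi_pos
  push_cast
  calc _ ≤ Real.log ‖q‖ * (n : ℝ) ^ 2 + |Real.log r| * |(n : ℝ)| := by gcongr
    _ = _ := by field_simp; ring

lemma exists_le_norm_zpow_inv_sub (hq0 : q ≠ 0) (hq : ‖q‖ < 1) (hz : z ≠ 0) {s : Set ℤ}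
    (hs : ∀ n ∈ s, q ^ n * z ≠ 1) : ∃ δ > 0, ∀ n ∈ s, δ ≤ ‖(q ^ n)⁻¹ - z‖ := by
  have hz' : 0 < ‖z‖ := norm_pos_iff.2 hz
  have hq' : 0 < ‖q‖ := norm_pos_iff.2 hq0
  have hfin : {n : ℤ | ¬ ‖z‖ / 2 ≤ ‖(q ^ n)⁻¹ - z‖}.Finite := by
    obtain ⟨N, hN⟩ := exists_pow_lt_of_lt_one (lt_min (half_pos hz') (inv_pos.2
      (mul_pos two_pos hz'))) hq
    obtain ⟨hN1, hN2⟩ := lt_min_iff.1 hN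
    refine (Set.finite_Ioo (-N : ℤ) N).subset fun n hn => ?_
    by_contra hn'
    refine hn ?_
    rcases not_and_or.1 hn' with h | h
    · have h1 : ‖q‖ ^ (-n) ≤ ‖q‖ ^ (N : ℤ) :=
        zpow_le_zpow_right_of_le_one₀ hq' hq.le (by omega)
      have h2 := norm_sub_norm_le z ((q ^ n)⁻¹)
      rw [← zpow_neg, norm_zpow, norm_sub_rev] at h2
      rw [zpow_natCast] at h1
      rw [← zpow_neg]
      linarith
    · have h1 : ‖q‖ ^ n ≤ ‖q‖ ^ (N : ℤ) :=
        zpow_le_zpow_right_of_le_one₀ hq' hq.le (by omega)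
      have h2 := norm_sub_norm_le ((q ^ n)⁻¹) z
      rw [norm_inv, norm_zpow] at h2
      rw [zpow_natCast] at h1
      have h3 : 2 * ‖z‖ ≤ (‖q‖ ^ n)⁻¹ :=
        (le_inv_comm₀ (by positivity) (by positivity)).2 (h1.trans hN2.le)
      linarith
  have h1 : ∀ᶠ δ : ℝ in 𝓝[>] 0, ∀ n ∈ {n : ℤ | ¬ ‖z‖ / 2 ≤ ‖(q ^ n)⁻¹ - z‖},
      n ∈ s → δ ≤ ‖(q ^ n)⁻¹ - z‖ := by
    refine (eventually_all_finite hfin).2 fun n _ => ?_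
    by_cases hn : n ∈ s
    · have hpos : 0 < ‖(q ^ n)⁻¹ - z‖ := by
        refine norm_pos_iff.2 (sub_ne_zero.2 fun h => hs n hn ?_)
        rw [← h, mul_inv_cancel₀ (zpow_ne_zero n hq0)]
      filter_upwards [nhdsWithin_le_nhds (Iic_mem_nhds hpos)] with δ hδ _ using hδ
    · exact Eventually.of_forall fun δ h => absurd h hn
  have h2 : ∀ᶠ δ : ℝ in 𝓝[>] 0, δ ≤ ‖z‖ / 2 :=
    nhdsWithin_le_nhds (Iic_mem_nhds (half_pos hz'))
  obtain ⟨δ, hδ, hδ2, hδ0⟩ := (h1.and (h2.and self_mem_nhdsWithin)).exists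
  refine ⟨δ, hδ0, fun n hn => ?_⟩
  by_cases h : ‖z‖ / 2 ≤ ‖(q ^ n)⁻¹ - z‖
  · exact hδ2.trans h
  · exact hδ n h hn

theorem summable_and_analyticAt_tsum_div (hq0 : q ≠ 0) (hq : ‖q‖ < 1) (hz : z ≠ 0) {a : ℤ → ℂ}
    (ha : Summable fun n => ‖a n * (q ^ n)⁻¹‖) (h : ∀ n, a n ≠ 0 → q ^ n * z ≠ 1) :
    Summable (fun n => a n / (1 - q ^ n * z)) ∧
      AnalyticAt ℂ (fun w => ∑' n, a n / (1 - q ^ n * w)) z := by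
  obtain ⟨δ, hδ0, hδ⟩ := exists_le_norm_zpow_inv_sub hq0 hq hz (s := {n | a n ≠ 0}) h
  have hne : ∀ n, a n ≠ 0 → ∀ w ∈ Metric.ball z (δ / 2), δ / 2 ≤ ‖(q ^ n)⁻¹ - w‖ := by
    intro n hn w hw
    have h1 := hδ n hn
    have h2 : ‖w - z‖ < δ / 2 := by simpa [dist_eq_norm] using hw
    have h3 := norm_add_le ((q ^ n)⁻¹ - w) (w - z)
    rw [sub_add_sub_cancel] at h3
    linarith
  have hterm : ∀ n w, a n / (1 - q ^ n * w) = a n * (q ^ n)⁻¹ / ((q ^ n)⁻¹ - w) := by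
    intro n w
    have := zpow_ne_zero n hq0
    rw [← mul_div_mul_left (a n * (q ^ n)⁻¹) _ this, mul_sub, mul_inv_cancel₀ this]
    congr 1
    field_simp
  have hbd : ∀ n, ∀ w ∈ Metric.ball z (δ / 2),
      ‖a n / (1 - q ^ n * w)‖ ≤ ‖a n * (q ^ n)⁻¹‖ / (δ / 2) := by
    intro n w hw
    by_cases hn : a n = 0
    · simp [hn]
    rw [hterm, norm_div]
    exact div_le_div_of_nonneg_left (norm_nonneg _) (half_pos hδ0) (hne n hn w hw)
  have hzb : z ∈ Metric.ball z (δ / 2) := Metric.mem_ball_self (half_pos hδ0)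
  have hs := ha.div_const (δ / 2)
  refine ⟨Summable.of_norm_bounded hs fun n => hbd n z hzb, ?_⟩
  refine (Complex.differentiableOn_tsum_of_summable_norm hs (fun n w hw => ?_) Metric.isOpen_ball
    hbd).analyticAt (Metric.isOpen_ball.mem_nhds hzb)
  by_cases hn : a n = 0
  · simp only [hn, zero_div]
    exact differentiableWithinAt_const 0
  have hw0 : 1 - q ^ n * w ≠ 0 := by
    intro h0
    have h1 := (half_pos hδ0).trans_le (hne n hn w hw)
    refine norm_pos_iff.1 h1 (sub_eq_zero.2 (eq_comm.1 (eq_inv_of_mul_eq_one_right ?_)))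
    linear_combination -h0
  exact DifferentiableAt.differentiableWithinAt (by fun_prop (disch := exact hw0))
noncomputable def appellCoeff (q b : ℂ) (n : ℤ) : ℂ := (-1) ^ n * q ^ (n ^ 2 + n) * b ^ (2 * n)

noncomputable def appellSum (q b y : ℂ) : ℂ := ∑' n : ℤ, appellCoeff q b n / (1 - q ^ n * y)

/-- The sum `appellSum` without its term at `n = 0`. -/
noncomputable def appellSumErase (q b y : ℂ) : ℂ :=
  ∑' n : ℤ, (if n = 0 then 0 else appellCoeff q b n) / (1 - q ^ n * y)

lemma summable_norm_appellCoeff_mul_zpow (hq0 : q ≠ 0) (hq : ‖q‖ < 1) (hb : b ≠ 0) (k : ℤ) :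
    Summable fun n => ‖appellCoeff q b n * q ^ (k * n)‖ := by
  have hq' : 0 < ‖q‖ := norm_pos_iff.2 hq0
  have hb' : 0 < ‖b‖ := norm_pos_iff.2 hb
  refine (summable_norm_pow_sq_mul_zpow hq0 hq
    (r := ‖q‖ ^ (1 + k) * ‖b‖ ^ (2 : ℤ)) (by positivity)).congr fun n => ?_
  simp only [appellCoeff, norm_mul, norm_zpow, norm_neg, norm_one, one_zpow, one_mul]
  rw [mul_zpow, ← zpow_mul, ← zpow_mul, ← mul_assoc, ← zpow_add₀ hq'.ne', mul_right_comm,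
    ← zpow_add₀ hq'.ne']
  ring_nf

lemma summable_norm_appellCoeff_mul_inv (hq0 : q ≠ 0) (hq : ‖q‖ < 1) (hb : b ≠ 0) :
    Summable fun n => ‖appellCoeff q b n * (q ^ n)⁻¹‖ := by
  simpa [neg_mul] using summable_norm_appellCoeff_mul_zpow hq0 hq hb (-1)

lemma analyticAt_appellSum (hq0 : q ≠ 0) (hq : ‖q‖ < 1) (hb : b ≠ 0) (hy : y ≠ 0)
    (h : ∀ n : ℤ, q ^ n * y ≠ 1) : AnalyticAt ℂ (appellSum q b) y :=
  (summable_and_analyticAt_tsum_div hq0 hq hy (summable_norm_appellCoeff_mul_inv hq0 hq hb)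
    fun n _ => h n).2

lemma summable_appellSum (hq0 : q ≠ 0) (hq : ‖q‖ < 1) (hb : b ≠ 0) (hy : y ≠ 0)
    (h : ∀ n : ℤ, q ^ n * y ≠ 1) : Summable fun n => appellCoeff q b n / (1 - q ^ n * y) :=
  (summable_and_analyticAt_tsum_div hq0 hq hy (summable_norm_appellCoeff_mul_inv hq0 hq hb)
    fun n _ => h n).1

lemma analyticAt_appellSumErase (hq0 : q ≠ 0) (hq : ‖q‖ < 1) (hb : b ≠ 0) (hy : y ≠ 0)
    (h : ∀ n : ℤ, n ≠ 0 → q ^ n * y ≠ 1) : AnalyticAt ℂ (appellSumErase q b) y := by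
  refine (summable_and_analyticAt_tsum_div hq0 hq hy
    ((summable_norm_appellCoeff_mul_inv hq0 hq hb).of_nonneg_of_le (fun _ => norm_nonneg _)
      fun n => ?_) fun n hn => h n fun h0 => hn (if_pos h0)).2
  split_ifs
  · rw [zero_mul, norm_zero]
    exact norm_nonneg _
  · rfl

lemma appellSum_eq_add_erase (hq0 : q ≠ 0) (hq : ‖q‖ < 1) (hb : b ≠ 0) (hy : y ≠ 0)
    (h : ∀ n : ℤ, q ^ n * y ≠ 1) : appellSum q b y = 1 / (1 - y) + appellSumErase q b y := by
  rw [appellSum, (summable_appellSum hq0 hq hb hy h).tsum_eq_add_tsum_ite 0, appellSumErase]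
  congr 1
  · simp [appellCoeff]
  · refine tsum_congr fun n => ?_
    split_ifs <;> simp

lemma appellSum_mul (hq0 : q ≠ 0) (hq : ‖q‖ < 1) (hb : b ≠ 0) (hy : y ≠ 0)
    (h : ∀ n : ℤ, q ^ n * y ≠ 1) :
    appellSum q b (q * y) = -(y / b) ^ 2 * appellSum q b y + ∑' n, appellCoeff q b n +
      y * q * ∑' n, appellCoeff q b n * q ^ n := by
  have e1 : appellSum q b (q * y) =
      ∑' n : ℤ, appellCoeff q b (n - 1) / (1 - q ^ n * y) := by
    rw [← (Equiv.subRight (1 : ℤ)).symm.tsum_eq, appellSum]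
    refine tsum_congr fun n => ?_
    simp only [Equiv.subRight_symm_apply, add_sub_cancel_right, zpow_add_one₀ hq0, mul_assoc]
  have s0 : Summable fun n => appellCoeff q b n := by
    simpa using (summable_norm_appellCoeff_mul_zpow hq0 hq hb 0).of_norm
  have s1 : Summable fun n => appellCoeff q b n * q ^ n := by
    simpa using (summable_norm_appellCoeff_mul_zpow hq0 hq hb 1).of_norm
  have h0 := (Equiv.subRight (1 : ℤ)).hasSum_iff.2 s0.hasSum
  have h1 := (Equiv.subRight (1 : ℤ)).hasSum_iff.2 s1.hasSum
  have h2 := (summable_appellSum hq0 hq hb hy h).hasSum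
  rw [e1]
  refine HasSum.tsum_eq ((((h2.mul_left (-(y / b) ^ 2)).add h0).add
    (h1.mul_left (y * q))).congr_fun fun n => ?_)
  have hn : 1 - q ^ n * y ≠ 0 := sub_ne_zero.2 (h n).symm
  have hc : appellCoeff q b n = -appellCoeff q b (n - 1) * (q ^ n) ^ 2 * b ^ 2 := by
    have e : q ^ (n ^ 2 + n) = q ^ ((n - 1) ^ 2 + (n - 1)) * (q ^ n) ^ 2 := by
      rw [← zpow_natCast (q ^ n), ← zpow_mul, ← zpow_add₀ hq0]
      ring_nf
    have e' : b ^ (2 * n) = b ^ (2 * (n - 1)) * b ^ 2 := by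
      rw [← zpow_natCast b, ← zpow_add₀ hb]
      ring_nf
    rw [appellCoeff, appellCoeff, e, e', zpow_sub_one₀ (by norm_num : (-1 : ℂ) ≠ 0)]
    norm_num
    ring
  have hq1 : q * q ^ (n - 1) = q ^ n := by rw [mul_comm, ← zpow_add_one₀ hq0, sub_add_cancel]
  simp only [Function.comp_apply, Equiv.subRight_apply]
  rw [hc, show y * q * (appellCoeff q b (n - 1) * q ^ (n - 1)) =
    appellCoeff q b (n - 1) * (q ^ n * y) by rw [← hq1]; ring]
  field_simp
  ring

end AppellSum

section AppellDefect

variable {q c z : ℂ} (q ζ : ℂ)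

noncomputable def appellMultiplier : ℂ :=
  ζ * qtheta q (-1) * qtheta q (ζ ^ 2) / (qtheta q ζ * qtheta q (-1 * ζ))

noncomputable def appellQuotientConst : ℂ :=
  poch q q ^ 2 * qtheta q ζ * qtheta q (ζ ^ 2) / qtheta q (-1 * ζ)

noncomputable def appellQuotient (z : ℂ) : ℂ :=
  appellQuotientConst q ζ * qtheta q (-1 * z) /
    (qtheta q z * qtheta q (ζ * z) * qtheta q (ζ⁻¹ * z))

/-- The difference of the two sides of the three-term relation for `appellSum`. -/
noncomputable def appellDefect (z : ℂ) : ℂ :=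
  appellSum q ζ⁻¹ (ζ⁻¹ * z) + ζ ^ 2 * appellSum q ζ (ζ * z)
    - appellMultiplier q ζ * appellSum q 1 z - appellQuotient q ζ z

variable {q ζ}

lemma qtheta_eq_zero_iff (hq0 : q ≠ 0) (hq : ‖q‖ < 1) (hz : z ≠ 0) :
    qtheta q z = 0 ↔ ∃ n : ℤ, q ^ n * z = 1 := by
  refine ⟨exists_zpow_mul_eq_one_of_qtheta_eq_zero hq0 hq hz, ?_⟩
  have hiff : ∀ y ≠ 0, qtheta q (q * y) = 0 ↔ qtheta q y = 0 := fun y hy => by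
    rw [qtheta_mul hq0 hq hy]
    simp [hy]
  have h : ∀ n : ℤ, qtheta q (q ^ n) = 0 := fun n => by
    induction n with
    | zero => simpa using qtheta_one hq
    | succ n ih => rwa [zpow_add_one₀ hq0, mul_comm, hiff _ (zpow_ne_zero _ hq0)]
    | pred n ih =>
      rw [← hiff _ (zpow_ne_zero _ hq0), mul_comm, ← zpow_add_one₀ hq0, sub_add_cancel]
      exact ih
  rintro ⟨n, hn⟩
  rw [eq_inv_of_mul_eq_one_right hn, ← zpow_neg]
  exact h (-n)

lemma zpow_mul_ne_one (hq0 : q ≠ 0) (hq : ‖q‖ < 1) (hz : z ≠ 0) (h : qtheta q z ≠ 0) (n : ℤ) :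
    q ^ n * z ≠ 1 :=
  fun hn => h ((qtheta_eq_zero_iff hq0 hq hz).2 ⟨n, hn⟩)

lemma zpow_ne_one (hq : ‖q‖ < 1) (n : ℤ) (hn : n ≠ 0) : q ^ n * 1 ≠ 1 := fun h => hn <| by
  have h' : ‖q‖ ^ n = 1 := by simpa using congrArg norm h
  exact (zpow_eq_one_iff_right₀ (norm_nonneg q) hq.ne).1 h'

lemma appellDefect_mul (hq0 : q ≠ 0) (hq : ‖q‖ < 1) (hζ : ζ ≠ 0) (hz : z ≠ 0)
    (h1 : qtheta q z ≠ 0) (h2 : qtheta q (ζ * z) ≠ 0) (h3 : qtheta q (ζ⁻¹ * z) ≠ 0) :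
    appellDefect q ζ (q * z) = -z ^ 2 * appellDefect q ζ z +
      ((∑' n, appellCoeff q ζ⁻¹ n + ζ ^ 2 * ∑' n, appellCoeff q ζ n
        - appellMultiplier q ζ * ∑' n, appellCoeff q 1 n) +
      (ζ⁻¹ * q * ∑' n, appellCoeff q ζ⁻¹ n * q ^ n
        + ζ ^ 2 * (ζ * q * ∑' n, appellCoeff q ζ n * q ^ n)
        - appellMultiplier q ζ * (q * ∑' n, appellCoeff q 1 n * q ^ n)) * z) := by
  have hζi := inv_ne_zero hζ
  have hn := mul_ne_zero (neg_ne_zero.2 one_ne_zero) hz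
  have e : appellQuotient q ζ (q * z) = -z ^ 2 * appellQuotient q ζ z := by
    rw [appellQuotient, appellQuotient, mul_left_comm _ q z, mul_left_comm ζ q z,
      mul_left_comm ζ⁻¹ q z, qtheta_mul hq0 hq hn, qtheta_mul hq0 hq hz,
      qtheta_mul hq0 hq (mul_ne_zero hζ hz), qtheta_mul hq0 hq (mul_ne_zero hζi hz)]
    field_simp
  rw [appellDefect, e, mul_left_comm ζ q z, mul_left_comm ζ⁻¹ q z,
    appellSum_mul hq0 hq hζ (mul_ne_zero hζ hz)
      (zpow_mul_ne_one hq0 hq (mul_ne_zero hζ hz) h2),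
    appellSum_mul hq0 hq hζi (mul_ne_zero hζi hz)
      (zpow_mul_ne_one hq0 hq (mul_ne_zero hζi hz) h3),
    appellSum_mul hq0 hq one_ne_zero hz (zpow_mul_ne_one hq0 hq hz h1), appellDefect,
    mul_div_cancel_left₀ _ hζ, mul_div_cancel_left₀ _ hζi]
  ring

lemma analyticAt_appellSum_mul {b : ℂ} (hq0 : q ≠ 0) (hq : ‖q‖ < 1) (hb : b ≠ 0) (hc : c ≠ 0)
    (hz : z ≠ 0) (h : qtheta q (c * z) ≠ 0) :
    AnalyticAt ℂ (fun w => appellSum q b (c * w)) z :=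
  (analyticAt_appellSum hq0 hq hb (mul_ne_zero hc hz)
    (zpow_mul_ne_one hq0 hq (mul_ne_zero hc hz) h)).fun_comp (f := fun w => c * w) (by fun_prop)

lemma analyticAt_appellSumErase_mul {b : ℂ} (hq0 : q ≠ 0) (hq : ‖q‖ < 1) (hb : b ≠ 0)
    (h : c * z = 1) : AnalyticAt ℂ (fun w => appellSumErase q b (c * w)) z := by
  refine AnalyticAt.fun_comp (f := fun w => c * w) ?_ (by fun_prop)
  rw [h]
  exact analyticAt_appellSumErase hq0 hq hb one_ne_zero (zpow_ne_one hq)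

lemma analyticAt_appellDefect (hq0 : q ≠ 0) (hq : ‖q‖ < 1) (hζ : ζ ≠ 0) (hz : z ≠ 0)
    (h1 : qtheta q z ≠ 0) (h2 : qtheta q (ζ * z) ≠ 0) (h3 : qtheta q (ζ⁻¹ * z) ≠ 0) :
    AnalyticAt ℂ (appellDefect q ζ) z := by
  have hζi := inv_ne_zero hζ
  refine (((analyticAt_appellSum_mul hq0 hq hζi hζi hz h3).add (analyticAt_const.mul
    (analyticAt_appellSum_mul hq0 hq hζ hζ hz h2))).sub (analyticAt_const.mul
    (analyticAt_appellSum hq0 hq one_ne_zero hz (zpow_mul_ne_one hq0 hq hz h1)))).sub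
    ((analyticAt_const.mul (analyticAt_qtheta_mul hq (neg_ne_zero.2 one_ne_zero) hz)).div
      (((analyticAt_qtheta hq hz).mul (analyticAt_qtheta_mul hq hζ hz)).mul
        (analyticAt_qtheta_mul hq hζi hz)) (mul_ne_zero (mul_ne_zero h1 h2) h3))

lemma eventually_punctured_ne (hq0 : q ≠ 0) (hq : ‖q‖ < 1) (hζ : ζ ≠ 0) (hz : z ≠ 0) :
    ∀ᶠ w in 𝓝[≠] z, w ≠ 0 ∧ qtheta q w ≠ 0 ∧ qtheta q (ζ * w) ≠ 0 ∧ qtheta q (ζ⁻¹ * w) ≠ 0 := by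
  have hne : ∀ᶠ w : ℂ in 𝓝[≠] z, w ≠ 0 := nhdsWithin_le_nhds (isOpen_ne.mem_nhds hz)
  filter_upwards [hne, eventually_qtheta_mul_ne_zero hq0 hq (c := 1) one_ne_zero hz,
    eventually_qtheta_mul_ne_zero hq0 hq hζ hz,
    eventually_qtheta_mul_ne_zero hq0 hq (inv_ne_zero hζ) hz] with w h0 h1 h2 h3
  rw [one_mul] at h1
  exact ⟨h0, h1, h2, h3⟩

lemma removableAt_appellDefect_one (hq0 : q ≠ 0) (hq : ‖q‖ < 1) (hζ : ζ ≠ 0)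
    (h1 : qtheta q ζ ≠ 0) : RemovableAt (appellDefect q ζ) 1 := by
  have hζi := inv_ne_zero hζ
  have hP := poch_self_ne_zero hq
  have hc1 : qthetaCore q 1 ≠ 0 := by rw [qthetaCore_one]; exact pow_ne_zero 2 hP
  have h1' : qtheta q (ζ * 1) ≠ 0 := by rwa [mul_one]
  have h1i : qtheta q (ζ⁻¹ * 1) ≠ 0 := by
    rw [mul_one, qtheta_inv hq hζ]
    exact mul_ne_zero (neg_ne_zero.2 hζi) h1
  have key : ∀ᶠ w in 𝓝[≠] 1, appellDefect q ζ w =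
      (appellSum q ζ⁻¹ (ζ⁻¹ * w) + ζ ^ 2 * appellSum q ζ (ζ * w)
        - appellMultiplier q ζ * appellSumErase q 1 w)
      + (appellQuotientConst q ζ * qtheta q (-1 * 1) /
          (qthetaCore q 1 * qtheta q (ζ * 1) * qtheta q (ζ⁻¹ * 1))
        - appellQuotientConst q ζ * qtheta q (-1 * w) /
          (qthetaCore q w * qtheta q (ζ * w) * qtheta q (ζ⁻¹ * w))) / (1 - w / 1) := by
    filter_upwards [eventually_punctured_ne hq0 hq hζ one_ne_zero, self_mem_nhdsWithin]
      with w ⟨h0, h3, h4, h5⟩ hw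
    have hw' : 1 - w ≠ 0 := sub_ne_zero.2 (Ne.symm hw)
    have e : appellQuotientConst q ζ * qtheta q (-1 * 1) /
        (qthetaCore q 1 * qtheta q (ζ * 1) * qtheta q (ζ⁻¹ * 1)) = -appellMultiplier q ζ := by
      rw [mul_one, mul_one, mul_one, qtheta_inv hq hζ, qthetaCore_one, appellQuotientConst,
        appellMultiplier]
      field_simp
    rw [appellDefect, appellQuotient, e,
      appellSum_eq_add_erase hq0 hq one_ne_zero h0 (zpow_mul_ne_one hq0 hq h0 h3)]
    rw [qtheta_eq_mul_core hq w] at h3 ⊢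
    have hcw := (mul_ne_zero_iff.1 h3).2
    field_simp
    ring
  obtain ⟨F, hF, hF', -⟩ := exists_extension_of_simple_pole one_ne_zero
    (((analyticAt_appellSum_mul hq0 hq hζi hζi one_ne_zero h1i).add (analyticAt_const.mul
      (analyticAt_appellSum_mul hq0 hq hζ hζ one_ne_zero h1'))).sub (analyticAt_const.mul
      (analyticAt_appellSumErase hq0 hq one_ne_zero one_ne_zero (zpow_ne_one hq))))
    ((analyticAt_const.mul (analyticAt_qtheta_mul hq (neg_ne_zero.2 one_ne_zero) one_ne_zero)).div
      (((analyticAt_qthetaCore hq one_ne_zero).mul (analyticAt_qtheta_mul hq hζ one_ne_zero)).mul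
        (analyticAt_qtheta_mul hq hζi one_ne_zero)) (mul_ne_zero (mul_ne_zero hc1 h1') h1i)) key
  exact ⟨F, hF, hF'⟩

lemma removableAt_appellDefect_inv (hq0 : q ≠ 0) (hq : ‖q‖ < 1) (hζ : ζ ≠ 0)
    (h1 : qtheta q ζ ≠ 0) (h2 : qtheta q (-1 * ζ) ≠ 0) (h3 : qtheta q (ζ ^ 2) ≠ 0) :
    RemovableAt (appellDefect q ζ) ζ⁻¹ := by
  have hζi := inv_ne_zero hζ
  have hζ2 := pow_ne_zero 2 hζ
  have hP := poch_self_ne_zero hq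
  have hc1 : qthetaCore q 1 ≠ 0 := by rw [qthetaCore_one]; exact pow_ne_zero 2 hP
  have hc : qthetaCore q (ζ * ζ⁻¹) ≠ 0 := by rwa [mul_inv_cancel₀ hζ]
  have e1 : ζ⁻¹ * ζ⁻¹ = (ζ ^ 2)⁻¹ := by rw [sq, mul_inv]
  have h1i : qtheta q ζ⁻¹ ≠ 0 := by
    rw [qtheta_inv hq hζ]
    exact mul_ne_zero (neg_ne_zero.2 hζi) h1
  have h3i : qtheta q (ζ⁻¹ * ζ⁻¹) ≠ 0 := by
    rw [e1, qtheta_inv hq hζ2]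
    exact mul_ne_zero (neg_ne_zero.2 (inv_ne_zero hζ2)) h3
  have key : ∀ᶠ w in 𝓝[≠] ζ⁻¹, appellDefect q ζ w =
      (appellSum q ζ⁻¹ (ζ⁻¹ * w) + ζ ^ 2 * appellSumErase q ζ (ζ * w)
        - appellMultiplier q ζ * appellSum q 1 w)
      + (appellQuotientConst q ζ * qtheta q (-1 * ζ⁻¹) /
          (qtheta q ζ⁻¹ * qthetaCore q (ζ * ζ⁻¹) * qtheta q (ζ⁻¹ * ζ⁻¹))
        - appellQuotientConst q ζ * qtheta q (-1 * w) /
          (qtheta q w * qthetaCore q (ζ * w) * qtheta q (ζ⁻¹ * w))) / (1 - w / ζ⁻¹) := by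
    filter_upwards [eventually_punctured_ne hq0 hq hζ hζi, self_mem_nhdsWithin]
      with w ⟨h0, h4, h5, h6⟩ hw
    have hw' : 1 - ζ * w ≠ 0 := fun h => hw (eq_inv_of_mul_eq_one_right (by
      linear_combination -h))
    have e : appellQuotientConst q ζ * qtheta q (-1 * ζ⁻¹) /
        (qtheta q ζ⁻¹ * qthetaCore q (ζ * ζ⁻¹) * qtheta q (ζ⁻¹ * ζ⁻¹)) = ζ ^ 2 := by
      rw [show -1 * ζ⁻¹ = (-1 * ζ)⁻¹ by rw [mul_inv]; norm_num, e1, mul_inv_cancel₀ hζ,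
        qtheta_inv hq hζ, qtheta_inv hq hζ2, qthetaCore_one, appellQuotientConst,
        qtheta_inv hq (mul_ne_zero (neg_ne_zero.2 one_ne_zero) hζ)]
      generalize qtheta q (-1 * ζ) = t at h2 ⊢
      field_simp
    rw [appellDefect, appellQuotient, e, div_inv_eq_mul, mul_comm w ζ,
      appellSum_eq_add_erase hq0 hq hζ (mul_ne_zero hζ h0)
        (zpow_mul_ne_one hq0 hq (mul_ne_zero hζ h0) h5)]
    rw [qtheta_eq_mul_core hq (ζ * w)] at h5 ⊢
    have hcw := (mul_ne_zero_iff.1 h5).2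
    field_simp
    ring
  obtain ⟨F, hF, hF', -⟩ := exists_extension_of_simple_pole hζi
    (((analyticAt_appellSum_mul hq0 hq hζi hζi hζi h3i).add (analyticAt_const.mul
      (analyticAt_appellSumErase_mul hq0 hq hζ (mul_inv_cancel₀ hζ)))).sub
      (analyticAt_const.mul (analyticAt_appellSum hq0 hq one_ne_zero hζi
        (zpow_mul_ne_one hq0 hq hζi h1i))))
    ((analyticAt_const.mul (analyticAt_qtheta_mul hq (neg_ne_zero.2 one_ne_zero) hζi)).div
      (((analyticAt_qtheta hq hζi).mul (analyticAt_qthetaCore_mul hq hζ hζi)).mul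
        (analyticAt_qtheta_mul hq hζi hζi))
      (mul_ne_zero (mul_ne_zero h1i hc) h3i)) key
  exact ⟨F, hF, hF'⟩

lemma hasDerivAt_qtheta_mul (hq : ‖q‖ < 1) (hc : c ≠ 0) (hz : z ≠ 0)
    (h : qtheta q (c * z) ≠ 0) : HasDerivAt (fun w => qtheta q (c * w))
      (-qthetaLog q (c * z) * qtheta q (c * z) / z) z := by
  have hd := (analyticAt_qtheta hq (mul_ne_zero hc hz)).differentiableAt.hasDerivAt
  have hm : HasDerivAt (fun w => c * w) c z := by simpa using (hasDerivAt_id z).const_mul c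
  refine (hd.comp z hm).congr_deriv ?_
  rw [qthetaLog]
  field_simp

lemma exists_extension_appellDefect (hq0 : q ≠ 0) (hq : ‖q‖ < 1) (hζ : ζ ≠ 0)
    (h1 : qtheta q ζ ≠ 0) (h2 : qtheta q (-1 * ζ) ≠ 0) (h3 : qtheta q (ζ ^ 2) ≠ 0) :
    ∃ F : ℂ → ℂ, AnalyticAt ℂ F ζ ∧ appellDefect q ζ =ᶠ[𝓝[≠] ζ] F ∧
      F ζ = appellSumErase q ζ⁻¹ 1 + ζ ^ 2 * appellSum q ζ (ζ ^ 2)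
        - appellMultiplier q ζ * appellSum q 1 ζ
        + (qthetaLog q ζ + qthetaLog q (ζ ^ 2) - qthetaLog q (-1 * ζ)) := by
  have hζi := inv_ne_zero hζ
  have hn1 : (-1 : ℂ) ≠ 0 := neg_ne_zero.2 one_ne_zero
  have hP := poch_self_ne_zero hq
  have hc1 : qthetaCore q 1 ≠ 0 := by rw [qthetaCore_one]; exact pow_ne_zero 2 hP
  have hii : ζ⁻¹ * ζ = 1 := inv_mul_cancel₀ hζ
  have hc : qthetaCore q (ζ⁻¹ * ζ) ≠ 0 := by rwa [hii]
  have h3' : qtheta q (ζ * ζ) ≠ 0 := by rwa [← sq]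
  have hg1 : appellQuotientConst q ζ * qtheta q (-1 * ζ) /
      (qtheta q ζ * qtheta q (ζ * ζ) * qthetaCore q (ζ⁻¹ * ζ)) = 1 := by
    rw [hii, qthetaCore_one, appellQuotientConst, ← sq]
    generalize qtheta q (-1 * ζ) = t at h2 ⊢
    field_simp
  have key : ∀ᶠ w in 𝓝[≠] ζ, appellDefect q ζ w =
      (appellSumErase q ζ⁻¹ (ζ⁻¹ * w) + ζ ^ 2 * appellSum q ζ (ζ * w)
        - appellMultiplier q ζ * appellSum q 1 w)
      + (appellQuotientConst q ζ * qtheta q (-1 * ζ) /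
          (qtheta q ζ * qtheta q (ζ * ζ) * qthetaCore q (ζ⁻¹ * ζ))
        - appellQuotientConst q ζ * qtheta q (-1 * w) /
          (qtheta q w * qtheta q (ζ * w) * qthetaCore q (ζ⁻¹ * w))) / (1 - w / ζ) := by
    filter_upwards [eventually_punctured_ne hq0 hq hζ hζ, self_mem_nhdsWithin]
      with w ⟨h0, h4, h5, h6⟩ hw
    have hw' : 1 - ζ⁻¹ * w ≠ 0 := fun h => hw (by
      have := eq_inv_of_mul_eq_one_right (a := ζ⁻¹) (b := w) (by linear_combination -h)
      rwa [inv_inv] at this)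
    rw [appellDefect, appellQuotient, hg1, div_eq_inv_mul w ζ,
      appellSum_eq_add_erase hq0 hq hζi (mul_ne_zero hζi h0)
        (zpow_mul_ne_one hq0 hq (mul_ne_zero hζi h0) h6)]
    rw [qtheta_eq_mul_core hq (ζ⁻¹ * w)] at h6 ⊢
    have hcw := (mul_ne_zero_iff.1 h6).2
    generalize qthetaCore q (ζ⁻¹ * w) = C at *
    generalize appellSumErase q ζ⁻¹ (ζ⁻¹ * w) = S at *
    generalize ζ⁻¹ * w = v at *
    field_simp
    ring
  obtain ⟨F, hF, hF', hFζ⟩ := exists_extension_of_simple_pole hζ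
    (((analyticAt_appellSumErase_mul hq0 hq hζi hii).add (analyticAt_const.mul
      (analyticAt_appellSum_mul hq0 hq hζ hζ hζ h3'))).sub
      (analyticAt_const.mul (analyticAt_appellSum hq0 hq one_ne_zero hζ
        (zpow_mul_ne_one hq0 hq hζ h1))))
    ((analyticAt_const.mul (analyticAt_qtheta_mul hq hn1 hζ)).div
      (((analyticAt_qtheta hq hζ).mul (analyticAt_qtheta_mul hq hζ hζ)).mul
        (analyticAt_qthetaCore_mul hq hζi hζ))
      (mul_ne_zero (mul_ne_zero h1 h3') hc)) key
  refine ⟨F, hF, hF', ?_⟩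
  have d1 := hasDerivAt_qtheta_mul hq hn1 hζ h2
  have d2 := hasDerivAt_qtheta_mul (c := 1) hq one_ne_zero hζ (by rwa [one_mul])
  simp only [one_mul] at d2
  have d3 := hasDerivAt_qtheta_mul hq hζ hζ h3'
  have d4 : HasDerivAt (fun w => qthetaCore q (ζ⁻¹ * w)) 0 ζ := by
    have hd := (analyticAt_qthetaCore hq (mul_ne_zero hζi hζ)).differentiableAt.hasDerivAt
    have hm : HasDerivAt (fun w => ζ⁻¹ * w) ζ⁻¹ ζ := by
      simpa using (hasDerivAt_id ζ).const_mul ζ⁻¹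
    refine (hd.comp ζ hm).congr_deriv ?_
    rw [hii, deriv_qthetaCore_one hq, zero_mul]
  have hD := ((d1.const_mul (appellQuotientConst q ζ)).div ((d2.mul d3).mul d4)
    (mul_ne_zero (mul_ne_zero h1 h3') hc)).deriv
  have hlog : ζ * deriv (fun w => appellQuotientConst q ζ * qtheta q (-1 * w) /
      (qtheta q w * qtheta q (ζ * w) * qthetaCore q (ζ⁻¹ * w))) ζ =
      qthetaLog q ζ + qthetaLog q (ζ ^ 2) - qthetaLog q (-1 * ζ) := by
    refine Eq.trans (congrArg (ζ * ·) hD) ?_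
    have hN := (div_eq_one_iff_eq (mul_ne_zero (mul_ne_zero h1 h3') hc)).1 hg1
    have hN' : appellQuotientConst q ζ * (-qthetaLog q (-1 * ζ) * qtheta q (-1 * ζ) / ζ) =
        -qthetaLog q (-1 * ζ) *
          (qtheta q ζ * qtheta q (ζ * ζ) * qthetaCore q (ζ⁻¹ * ζ)) / ζ := by
      rw [← hN]
      ring
    simp only [Pi.mul_apply]
    rw [hN, hN', sq ζ]
    generalize qtheta q (ζ * ζ) = t₂ at h3' ⊢
    generalize qthetaCore q (ζ⁻¹ * ζ) = t₃ at hc ⊢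
    field_simp
    ring
  refine hFζ.trans ?_
  refine congrArg₂ (· + ·) ?_ hlog
  simp only [Pi.add_apply, Pi.sub_apply, Pi.mul_apply]
  rw [hii, ← sq]

/-- A three-term relation between the Appell sums with parameters `ζ⁻¹`, `ζ` and `1`. -/
theorem appellSumErase_add_appellSum (hq0 : q ≠ 0) (hq : ‖q‖ < 1) (hζ : ζ ≠ 0)
    (h1 : qtheta q ζ ≠ 0) (h2 : qtheta q (-1 * ζ) ≠ 0) (h3 : qtheta q (ζ ^ 2) ≠ 0) :
    appellSumErase q ζ⁻¹ 1 + ζ ^ 2 * appellSum q ζ (ζ ^ 2) =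
      appellMultiplier q ζ * appellSum q 1 ζ
        + (qthetaLog q (-1 * ζ) - qthetaLog q ζ - qthetaLog q (ζ ^ 2)) := by
  have hζi := inv_ne_zero hζ
  obtain ⟨u, v, huv⟩ : ∃ u v : ℂ, ∀ z ≠ 0, qtheta q z ≠ 0 → qtheta q (ζ * z) ≠ 0 →
      qtheta q (ζ⁻¹ * z) ≠ 0 →
      appellDefect q ζ (q * z) = -z ^ 2 * appellDefect q ζ z + (u + v * z) :=
    ⟨_, _, fun z hz => appellDefect_mul hq0 hq hζ hz⟩
  have hfe : ∀ z ≠ 0, ∀ᶠ w in 𝓝[≠] z,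
      appellDefect q ζ (q * w) = -w ^ 2 * appellDefect q ζ w + (u + v * w) := by
    intro z hz
    filter_upwards [eventually_punctured_ne hq0 hq hζ hz] with w ⟨h0, h4, h5, h6⟩
    exact huv w h0 h4 h5 h6
  have ha : ∀ z : ℂ, z ≠ 0 → AnalyticAt ℂ (fun w : ℂ => -w ^ 2) z := fun z _ => by fun_prop
  have hb : ∀ z : ℂ, z ≠ 0 → AnalyticAt ℂ (fun w : ℂ => u + v * w) z := fun z _ => by fun_prop
  have htr : ∀ p ≠ 0, RemovableAt (appellDefect q ζ) p → ∀ z, (∃ n : ℤ, q ^ n * z = p) →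
      RemovableAt (appellDefect q ζ) z := by
    rintro p hp0 hp z ⟨n, rfl⟩
    have := hp.zpow_mul hq0 ha hb (fun z hz => neg_ne_zero.2 (pow_ne_zero 2 hz)) hfe hp0 (-n)
    rwa [← mul_assoc, ← zpow_add₀ hq0, neg_add_cancel, zpow_zero, one_mul] at this
  obtain ⟨F, hF, hDF, hFζ⟩ := exists_extension_appellDefect hq0 hq hζ h1 h2 h3
  have hrem : ∀ z ≠ 0, RemovableAt (appellDefect q ζ) z := by
    intro z hz
    by_cases h4 : qtheta q z = 0
    · exact htr 1 one_ne_zero (removableAt_appellDefect_one hq0 hq hζ h1) z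
        ((qtheta_eq_zero_iff hq0 hq hz).1 h4)
    by_cases h5 : qtheta q (ζ * z) = 0
    · refine htr _ hζi (removableAt_appellDefect_inv hq0 hq hζ h1 h2 h3) z ?_
      obtain ⟨n, hn⟩ := (qtheta_eq_zero_iff hq0 hq (mul_ne_zero hζ hz)).1 h5
      exact ⟨n, eq_inv_of_mul_eq_one_right (by rw [← hn]; ring)⟩
    by_cases h6 : qtheta q (ζ⁻¹ * z) = 0
    · refine htr _ hζ ⟨F, hF, hDF⟩ z ?_
      obtain ⟨n, hn⟩ := (qtheta_eq_zero_iff hq0 hq (mul_ne_zero hζi hz)).1 h6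
      refine ⟨n, ?_⟩
      rw [← mul_one ζ, ← hn]
      field_simp
    exact (analyticAt_appellDefect hq0 hq hζ hz h4 h5 h6).removableAt
  obtain ⟨c, hc, hc'⟩ := eventuallyEq_const_of_functional_eq hq0 hq ha hb hfe hrem
    (M₀ := 2 * (‖u‖ + ‖v‖))
    (fun M hM z _ hz s hs => by
      have hM0 : 0 ≤ M := le_trans (by positivity) hM
      calc ‖-z ^ 2 * s + (u + v * z)‖ ≤ ‖z‖ ^ 2 * ‖s‖ + (‖u‖ + ‖v‖ * ‖z‖) := by
            refine (norm_add_le _ _).trans ?_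
            refine add_le_add ?_ ((norm_add_le _ _).trans ?_)
            · rw [norm_mul, norm_neg, norm_pow]
            · rw [norm_mul]
        _ ≤ (1 / 2) ^ 2 * M + (‖u‖ + ‖v‖ * (1 / 2)) := by gcongr
        _ ≤ M := by linarith [norm_nonneg u, norm_nonneg v])
    (fun M hM z hz s hs => by
      have h7 : ‖z‖ ^ 2 * ‖s‖ ≤ M + (‖u‖ + ‖v‖ * ‖z‖) := by
        calc ‖z‖ ^ 2 * ‖s‖ = ‖(-z ^ 2 * s + (u + v * z)) - (u + v * z)‖ := by
              rw [add_sub_cancel_right, norm_mul, norm_neg, norm_pow]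
          _ ≤ ‖-z ^ 2 * s + (u + v * z)‖ + ‖u + v * z‖ := norm_sub_le _ _
          _ ≤ _ := add_le_add hs ((norm_add_le _ _).trans (by rw [norm_mul]))
      by_contra! hlt
      have hM0 : 0 ≤ M := le_trans (by positivity) hM
      have hz0 : 0 < ‖z‖ ^ 2 := pow_pos (by linarith) 2
      have h8 : ‖z‖ ^ 2 * M < ‖z‖ ^ 2 * ‖s‖ := mul_lt_mul_of_pos_left hlt hz0
      have h9 : 0 ≤ (‖z‖ - 2) * (‖z‖ + 1) * M :=
        mul_nonneg (mul_nonneg (by linarith) (by linarith)) hM0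
      have h10 : 0 ≤ (‖z‖ + 1) * (M - 2 * (‖u‖ + ‖v‖)) :=
        mul_nonneg (by linarith) (by linarith)
      have h11 := mul_nonneg (norm_nonneg u) (norm_nonneg z)
      have h12 := mul_nonneg (norm_nonneg v) (norm_nonneg z)
      linarith [norm_nonneg u, norm_nonneg v])
  have hc0 : c = 0 := by
    have e1 := hc' 1 one_ne_zero
    have e2 := hc' (-1) (by norm_num)
    have e3 := hc' 2 two_ne_zero
    linear_combination (1 / 3 : ℂ) * e3 - 1 / 2 * e1 + 1 / 6 * e2
  have h0 := hF.eq_const_of_eventuallyEq (hDF.symm.trans (hc ζ hζ))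
  rw [hFζ, hc0] at h0
  linear_combination h0

end AppellDefect

section Specialization

variable {q x y : ℂ}

lemma poch_pow_ne_zero (hx : ‖x‖ < 1) {m k : ℕ} (hk : k ≠ 0) (hm : m ≠ 0) :
    poch (x ^ k) (x ^ m) ≠ 0 := by
  refine poch_ne_zero (by rw [norm_pow]; exact pow_lt_one₀ (norm_nonneg x) hx hm) fun n h => ?_
  rw [← pow_mul, ← pow_add] at h
  have h1 : ‖x‖ ^ (k + m * n) = 1 := by rw [← norm_pow, h, norm_one]
  exact (pow_lt_one₀ (norm_nonneg x) hx (by omega)).ne h1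

lemma qtheta_pow_three_ne_zero (hx0 : x ≠ 0) (hx : ‖x‖ < 1) {k : ℕ} (hk : ¬ 3 ∣ k)
    (hy : ‖y‖ = ‖x‖ ^ k) : qtheta (x ^ 3) y ≠ 0 := by
  have hx' : 0 < ‖x‖ := norm_pos_iff.2 hx0
  have hy0 : y ≠ 0 := norm_pos_iff.1 (hy ▸ pow_pos hx' k)
  refine qtheta_ne_zero (pow_ne_zero 3 hx0)
    (by rw [norm_pow]; exact pow_lt_one₀ (norm_nonneg x) hx (by norm_num)) hy0 fun n h => ?_
  have h1 : ‖x‖ ^ (3 * n + k) = 1 := by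
    rw [zpow_add₀ hx'.ne', zpow_mul, zpow_natCast, ← hy]
    simpa using congrArg norm h
  have := (zpow_eq_one_iff_right₀ (norm_nonneg x) hx.ne).1 h1
  omega

lemma poch_neg_mul_poch_neg (hx : ‖x‖ < 1) :
    poch x (x ^ 6) * poch (x ^ 5) (x ^ 6) * (poch (-x) (x ^ 3) * poch (-x ^ 2) (x ^ 3)) = 1 := by
  have hx3 : ‖x ^ 3‖ < 1 := by
    rw [norm_pow]; exact pow_lt_one₀ (norm_nonneg x) hx (by norm_num)
  have h1 := poch_sq x hx3
  have h2 := poch_sq (x ^ 2) hx3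
  rw [poch_dissect_two x hx3] at h1
  rw [poch_dissect_two (x ^ 2) hx3] at h2
  have a2 := poch_pow_ne_zero hx (m := 6) two_ne_zero (by norm_num)
  have a4 := poch_pow_ne_zero hx (m := 6) four_ne_zero (by norm_num)
  ring_nf at h1 h2 a2 a4 ⊢
  refine mul_left_cancel₀ (mul_ne_zero a2 a4) ?_
  rw [mul_one]
  linear_combination -poch (x ^ 2) (x ^ 6) * poch (x ^ 5) (x ^ 6) * poch (-x ^ 2) (x ^ 3) * h1 -
    poch (x ^ 2) (x ^ 6) * h2

lemma poch_neg_pow_three (hx : ‖x‖ < 1) : poch (x ^ 3) (x ^ 6) * poch (-x ^ 3) (x ^ 3) = 1 := by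
  have hx3 : ‖x ^ 3‖ < 1 := by
    rw [norm_pow]; exact pow_lt_one₀ (norm_nonneg x) hx (by norm_num)
  have h1 := poch_sq (x ^ 3) hx3
  rw [poch_dissect_two (x ^ 3) hx3] at h1
  have a6 := poch_pow_ne_zero hx (m := 6) (k := 6) (by norm_num) (by norm_num)
  ring_nf at h1 a6 ⊢
  refine mul_left_cancel₀ a6 ?_
  linear_combination -h1

lemma qtheta_pow_three_self (hx0 : x ≠ 0) (hx : ‖x‖ < 1) : qtheta (x ^ 3) x =
    poch x (x ^ 6) * poch (x ^ 4) (x ^ 6) * (poch (x ^ 2) (x ^ 6) * poch (x ^ 5) (x ^ 6)) := by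
  have hx3 : ‖x ^ 3‖ < 1 := by
    rw [norm_pow]; exact pow_lt_one₀ (norm_nonneg x) hx (by norm_num)
  rw [qtheta, show x ^ 3 / x = x ^ 2 by field_simp, poch_dissect_two x hx3,
    poch_dissect_two (x ^ 2) hx3]
  ring_nf

lemma qtheta_pow_three_sq (hx0 : x ≠ 0) : qtheta (x ^ 3) (x ^ 2) = qtheta (x ^ 3) x := by
  rw [← qtheta_div (pow_ne_zero 3 hx0), show x ^ 3 / x ^ 2 = x by field_simp]

lemma qtheta_pow_three_neg (hx0 : x ≠ 0) :
    qtheta (x ^ 3) (-1 * x) = poch (-x) (x ^ 3) * poch (-x ^ 2) (x ^ 3) := by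
  rw [qtheta, show x ^ 3 / (-1 * x) = -x ^ 2 by field_simp, neg_one_mul]

lemma qtheta_neg_one (hq : ‖q‖ < 1) : qtheta q (-1) = 2 * poch (-q) q ^ 2 := by
  rw [qtheta, poch_eq_mul (-1) hq, div_neg, div_one, neg_one_mul]
  ring

lemma appellMultiplier_pow_three (hx0 : x ≠ 0) (hx : ‖x‖ < 1) :
    appellMultiplier (x ^ 3) x =
      2 * (poch x (x ^ 6) * poch (x ^ 5) (x ^ 6) * poch (x ^ 6) (x ^ 6)) /
        (poch (x ^ 3) (x ^ 6) * poch (x ^ 3) (x ^ 6) * poch (x ^ 6) (x ^ 6)) * x := by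
  have hx3 : ‖x ^ 3‖ < 1 := by
    rw [norm_pow]; exact pow_lt_one₀ (norm_nonneg x) hx (by norm_num)
  have h1 := qtheta_pow_three_ne_zero hx0 hx (k := 1) (y := x) (by norm_num) (by simp)
  have hn := qtheta_pow_three_ne_zero hx0 hx (k := 1) (y := -1 * x) (by norm_num) (by simp)
  have a3 := poch_pow_ne_zero hx (m := 6) (k := 3) (by norm_num) (by norm_num)
  have a6 := poch_pow_ne_zero hx (m := 6) (k := 6) (by norm_num) (by norm_num)
  have e1 := poch_neg_mul_poch_neg hx
  have e2 := poch_neg_pow_three hx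
  rw [appellMultiplier, qtheta_pow_three_sq hx0, qtheta_neg_one hx3]
  rw [qtheta_pow_three_neg hx0] at hn ⊢
  rw [eq_inv_of_mul_eq_one_right e2, ← inv_inv (poch (-x) (x ^ 3) * poch (-x ^ 2) (x ^ 3)),
    ← eq_inv_of_mul_eq_one_left e1]
  have a1 := left_ne_zero_of_mul_eq_one e1
  obtain ⟨a1, a5⟩ := mul_ne_zero_iff.1 a1
  field_simp

lemma six_mul_qthetaLog_pow_three (hx0 : x ≠ 0) (hx : ‖x‖ < 1) :
    6 * qthetaLog (x ^ 3) (-1 * x) =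
      (poch x (x ^ 6) * poch (x ^ 5) (x ^ 6) * poch (x ^ 6) (x ^ 6)) ^ 6 *
        poch (x ^ 2) (x ^ 2) ^ 3 *
        (poch (x ^ 3) (x ^ 6) * poch (x ^ 3) (x ^ 6) * poch (x ^ 6) (x ^ 6)) ^ 2 /
        poch (x ^ 6) (x ^ 6) ^ 9 - 1 := by
  have hx30 := pow_ne_zero 3 hx0
  have hx3 : ‖x ^ 3‖ < 1 := by
    rw [norm_pow]; exact pow_lt_one₀ (norm_nonneg x) hx (by norm_num)
  have hx2 : ‖x ^ 2‖ < 1 := by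
    rw [norm_pow]; exact pow_lt_one₀ (norm_nonneg x) hx (by norm_num)
  have hneg := qtheta_neg_one_ne_zero hx30 hx3
  have hm1 : (-1 : ℂ) ≠ 0 := by norm_num
  have hn := qtheta_pow_three_ne_zero hx0 hx (k := 1) (y := -1 * x) (by norm_num) (by simp)
  have h2 := qtheta_pow_three_ne_zero hx0 hx (k := 2) (y := x ^ 2) (by norm_num) (by simp)
  have es : (-1 * x) ^ 2 = x ^ 2 := by ring
  have ec : (-1 * x) ^ 3 = x ^ 3 * -1 := by ring
  have hθ : qtheta (x ^ 3) (x ^ 3 * -1) = qtheta (x ^ 3) (-1) := by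
    rw [qtheta_mul hx30 hx3 hm1]
    norm_num
  have h3 := three_mul_qthetaLog hx30 hx3 (mul_ne_zero hm1 hx0) hn (by rwa [es])
    (by rwa [ec, hθ])
  rw [es, ec, hθ, qthetaLog_mul hx30 hx3 hm1 hneg, qthetaLog_neg_one hx3 hneg,
    qtheta_pow_three_sq hx0, qtheta_pow_three_self hx0 hx, qtheta_pow_three_neg hx0,
    qtheta_neg_one hx3] at h3
  have a3 := poch_pow_ne_zero hx (m := 6) (k := 3) (by norm_num) (by norm_num)
  have a6 := poch_pow_ne_zero hx (m := 6) (k := 6) (by norm_num) (by norm_num)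
  have e1 := poch_neg_mul_poch_neg hx
  have e2 := poch_neg_pow_three hx
  have e3 : poch (x ^ 2) (x ^ 2) =
      poch (x ^ 2) (x ^ 6) * poch (x ^ 4) (x ^ 6) * poch (x ^ 6) (x ^ 6) := by
    rw [poch_dissect_three _ hx2]
    ring_nf
  have e4 : poch (x ^ 3) (x ^ 3) = poch (x ^ 3) (x ^ 6) * poch (x ^ 6) (x ^ 6) := by
    rw [poch_dissect_two _ hx3]
    ring_nf
  have h13 := left_ne_zero_of_mul_eq_one e1
  obtain ⟨a1, a5⟩ := mul_ne_zero_iff.1 h13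
  rw [e4, eq_inv_of_mul_eq_one_right e2,
    ← inv_inv (poch (-x) (x ^ 3) * poch (-x ^ 2) (x ^ 3)),
    ← eq_inv_of_mul_eq_one_left e1] at h3
  rw [e3]
  have h4 : 6 * qthetaLog (x ^ 3) (-1 * x) = 2 * (3 * qthetaLog (x ^ 3) (-1 * x)
    - (-1 / 2 + 1) + 1) - 1 := by ring
  rw [h4, h3]
  congr 1
  field_simp

lemma qthetaLog_add_qthetaLog_sq (hx0 : x ≠ 0) (hx : ‖x‖ < 1) :
    qthetaLog (x ^ 3) x + qthetaLog (x ^ 3) (x ^ 2) = 0 := by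
  have hx30 := pow_ne_zero 3 hx0
  have hx3 : ‖x ^ 3‖ < 1 := by
    rw [norm_pow]; exact pow_lt_one₀ (norm_nonneg x) hx (by norm_num)
  have h1 := qtheta_pow_three_ne_zero hx0 hx (k := 1) (y := x) (by norm_num) (by simp)
  have h1i : qtheta (x ^ 3) x⁻¹ ≠ 0 := by
    rw [qtheta_inv hx3 hx0]
    exact mul_ne_zero (neg_ne_zero.2 (inv_ne_zero hx0)) h1
  rw [show x ^ 2 = x ^ 3 * x⁻¹ by field_simp, qthetaLog_mul hx30 hx3 (inv_ne_zero hx0) h1i,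
    qthetaLog_inv hx3 hx0 h1]
  ring

end Specialization

theorem stmt13 (q : ℂ) (hq0 : 0 < ‖q‖) (hq : ‖q‖ < 1)
    (hden : ∀ m : ℤ, m ≠ 0 → q ^ m ≠ 1) :
    (∑' n : ℤ, (if n = 0 then 0 else
        (-1 : ℂ) ^ n * q ^ (9 * n ^ 2 + 3 * n) / (1 - q ^ (9 * n))))
      + (∑' n : ℤ, (-1 : ℂ) ^ n * q ^ (9 * n ^ 2 + 15 * n + 6) / (1 - q ^ (9 * n + 6)))
      = 2 * Jam 3 18 q / Jam 9 18 q
          * (∑' n : ℤ, (-1 : ℂ) ^ n * q ^ (9 * n ^ 2 + 9 * n + 3) / (1 - q ^ (9 * n + 3)))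
        + (Jam 3 18 q) ^ 6 * (Jm 6 q) ^ 3 * (Jam 9 18 q) ^ 2 / (6 * (Jm 18 q) ^ 9)
        - 1 / 6 := by
  have hq1 : q ≠ 0 := norm_pos_iff.1 hq0
  obtain ⟨x, hx⟩ : ∃ x, x = q ^ 3 := ⟨_, rfl⟩
  have hx0 : x ≠ 0 := hx ▸ pow_ne_zero 3 hq1
  have hx1 : ‖x‖ < 1 := by
    rw [hx, norm_pow]; exact pow_lt_one₀ (norm_nonneg q) hq (by norm_num)
  have hx3 : ‖x ^ 3‖ < 1 := by
    rw [norm_pow]; exact pow_lt_one₀ (norm_nonneg x) hx1 (by norm_num)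
  have hz : ∀ n : ℤ, (x ^ 3) ^ n = q ^ (9 * n) := fun n => by
    rw [hx, ← pow_mul, ← zpow_natCast, ← zpow_mul]
    norm_num
  have hz' : ∀ n : ℤ, x ^ n = q ^ (3 * n) := fun n => by
    rw [hx, ← zpow_natCast, ← zpow_mul]
    norm_num
  have key := appellSumErase_add_appellSum (pow_ne_zero 3 hx0) hx3 hx0
    (qtheta_pow_three_ne_zero hx0 hx1 (k := 1) (by norm_num) (by simp))
    (qtheta_pow_three_ne_zero hx0 hx1 (k := 1) (by norm_num) (by simp))
    (qtheta_pow_three_ne_zero hx0 hx1 (k := 2) (by norm_num) (by simp))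
  have s1 : (∑' n : ℤ, (if n = 0 then 0 else
      (-1 : ℂ) ^ n * q ^ (9 * n ^ 2 + 3 * n) / (1 - q ^ (9 * n)))) =
      appellSumErase (x ^ 3) x⁻¹ 1 := by
    refine tsum_congr fun n => ?_
    split_ifs
    · rw [zero_div]
    · rw [appellCoeff, hz, hz, mul_one, inv_zpow', hz', mul_assoc, ← zpow_add₀ hq1]
      ring_nf
  have s2 : (∑' n : ℤ, (-1 : ℂ) ^ n * q ^ (9 * n ^ 2 + 15 * n + 6) / (1 - q ^ (9 * n + 6))) =
      x ^ 2 * appellSum (x ^ 3) x (x ^ 2) := by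
    rw [appellSum, ← tsum_mul_left]
    refine tsum_congr fun n => ?_
    rw [appellCoeff, hz, hz, ← zpow_natCast x, hz', hz', mul_assoc, ← zpow_add₀ hq1,
      ← zpow_add₀ hq1, ← mul_div_assoc, mul_left_comm, ← zpow_add₀ hq1]
    push_cast
    ring_nf
  have s3 : (∑' n : ℤ, (-1 : ℂ) ^ n * q ^ (9 * n ^ 2 + 9 * n + 3) / (1 - q ^ (9 * n + 3))) =
      x * appellSum (x ^ 3) 1 x := by
    rw [appellSum, ← tsum_mul_left]
    refine tsum_congr fun n => ?_
    rw [appellCoeff, hz, hz, one_zpow, mul_one, ← zpow_one x, hz', ← zpow_add₀ hq1,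
      ← mul_div_assoc, mul_left_comm, ← zpow_add₀ hq1]
    ring_nf
  have j3 : Jam 3 18 q = poch x (x ^ 6) * poch (x ^ 5) (x ^ 6) * poch (x ^ 6) (x ^ 6) := by
    simp only [Jam, hx, ← pow_mul]
  have j9 : Jam 9 18 q =
      poch (x ^ 3) (x ^ 6) * poch (x ^ 3) (x ^ 6) * poch (x ^ 6) (x ^ 6) := by
    simp only [Jam, hx, ← pow_mul]
  have j6 : Jm 6 q = poch (x ^ 2) (x ^ 2) := by simp only [Jm, hx, ← pow_mul]
  have j18 : Jm 18 q = poch (x ^ 6) (x ^ 6) := by simp only [Jm, hx, ← pow_mul]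
  have hL := six_mul_qthetaLog_pow_three hx0 hx1
  have hS := qthetaLog_add_qthetaLog_sq hx0 hx1
  rw [appellMultiplier_pow_three hx0 hx1, ← j3, ← j9] at key
  rw [← j3, ← j9, ← j6, ← j18] at hL
  rw [s1, s2, s3, key, mul_comm 6 (Jm 18 q ^ 9), ← div_div]
  linear_combination (1 / 6 : ℂ) * hL - hS
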